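/- arXiv:0908.4292 — 3 statements merged into one kernel-verified Lean document; each statement's English description precedes it below -/
import Mathlib

section
/- Let V : [1,∞) → ℝ be smooth with V(x) = ℓ(ℓ+1)/x² + O(x^{−3+ε}) for some ℓ ∈ ℕ, ℓ ≥ 1, and ε ∈ (0,1), where the O-term is of symbol type (each derivative gains one power of decay). Then there exists a smooth solution u₁ of −u₁'' + V u₁ = 0 on [1,∞) of the form u₁(x) = x^{−ℓ}(1 + a(x)) with |a^{(k)}(x)| ≤ C_k x^{−1+ε−k} for all k ∈ ℕ₀ and x ≥ 1. -/
open Set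

open MeasureTheory Filter Topology

open scoped BoundedContinuousFunction

/-- `f` is a symbol of order `m` on `[1,∞)` up to `n` derivatives: `|f^{(k)}(x)| ≤ C x^{m-k}` for
`k ≤ n`. -/
def IsSymbolUpTo : ℕ → ℝ → (ℝ → ℝ) → Prop
  | 0, m, f => (∃ C, ∀ x ∈ Ici (1 : ℝ), |f x| ≤ C * x ^ m) ∧ ContinuousOn f (Ici 1)
  | n + 1, m, f => (∃ C, ∀ x ∈ Ici (1 : ℝ), |f x| ≤ C * x ^ m) ∧
      ∃ g : ℝ → ℝ, (∀ x ∈ Ici (1 : ℝ), HasDerivWithinAt f (g x) (Ici 1) x) ∧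
        IsSymbolUpTo n (m - 1) g

namespace IsSymbolUpTo

variable {n : ℕ} {m m' : ℝ} {f g : ℝ → ℝ}

theorem continuousOn (hf : IsSymbolUpTo n m f) : ContinuousOn f (Ici 1) := by
  cases n with
  | zero => exact hf.2
  | succ n =>
    obtain ⟨_, g, hg, _⟩ := hf
    exact fun x hx => (hg x hx).continuousWithinAt

theorem of_succ (hf : IsSymbolUpTo (n + 1) m f) : IsSymbolUpTo n m f := by
  induction n generalizing m f with
  | zero => exact ⟨hf.1, hf.continuousOn⟩
  | succ n ih =>
    obtain ⟨hb, g, hg, hgs⟩ := hf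
    exact ⟨hb, g, hg, ih hgs⟩

theorem exists_bound_add (hf : ∃ C, ∀ x ∈ Ici (1 : ℝ), |f x| ≤ C * x ^ m)
    (hg : ∃ C, ∀ x ∈ Ici (1 : ℝ), |g x| ≤ C * x ^ m) :
    ∃ C, ∀ x ∈ Ici (1 : ℝ), |f x + g x| ≤ C * x ^ m := by
  obtain ⟨C, hC⟩ := hf
  obtain ⟨D, hD⟩ := hg
  refine ⟨C + D, fun x hx => (abs_add_le _ _).trans ?_⟩
  linarith [hC x hx, hD x hx]

theorem exists_bound_mul (hf : ∃ C, ∀ x ∈ Ici (1 : ℝ), |f x| ≤ C * x ^ m)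
    (hg : ∃ C, ∀ x ∈ Ici (1 : ℝ), |g x| ≤ C * x ^ m') :
    ∃ C, ∀ x ∈ Ici (1 : ℝ), |f x * g x| ≤ C * x ^ (m + m') := by
  obtain ⟨C, hC⟩ := hf
  obtain ⟨D, hD⟩ := hg
  refine ⟨C * D, fun x hx => ?_⟩
  have hx0 : (0 : ℝ) < x := zero_lt_one.trans_le hx
  rw [abs_mul, Real.rpow_add hx0, mul_mul_mul_comm]
  exact mul_le_mul (hC x hx) (hD x hx) (abs_nonneg _) ((abs_nonneg _).trans (hC x hx))

theorem add (hf : IsSymbolUpTo n m f) (hg : IsSymbolUpTo n m g) :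
    IsSymbolUpTo n m (fun x => f x + g x) := by
  induction n generalizing m f g with
  | zero => exact ⟨exists_bound_add hf.1 hg.1, hf.2.add hg.2⟩
  | succ n ih =>
    obtain ⟨hbf, f', hf', hfs⟩ := hf
    obtain ⟨hbg, g', hg', hgs⟩ := hg
    exact ⟨exists_bound_add hbf hbg, fun x => f' x + g' x,
      fun x hx => (hf' x hx).add (hg' x hx), ih hfs hgs⟩

theorem mul (hf : IsSymbolUpTo n m f) (hg : IsSymbolUpTo n m' g) :
    IsSymbolUpTo n (m + m') (fun x => f x * g x) := by
  induction n generalizing m m' f g with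
  | zero => exact ⟨exists_bound_mul hf.1 hg.1, hf.2.mul hg.2⟩
  | succ n ih =>
    have hf₀ := hf.of_succ
    have hg₀ := hg.of_succ
    obtain ⟨hbf, f', hf', hfs⟩ := hf
    obtain ⟨hbg, g', hg', hgs⟩ := hg
    refine ⟨exists_bound_mul hbf hbg, fun x => f' x * g x + f x * g' x,
      fun x hx => (hf' x hx).mul (hg' x hx), add ?_ ?_⟩
    · convert ih hfs hg₀ using 1
      ring
    · convert ih hf₀ hgs using 1
      ring

theorem mono (hf : IsSymbolUpTo n m f) (hm : m ≤ m') : IsSymbolUpTo n m' f := by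
  have key : ∀ {f : ℝ → ℝ} {m m' : ℝ}, m ≤ m' →
      (∃ C, ∀ x ∈ Ici (1 : ℝ), |f x| ≤ C * x ^ m) →
        ∃ C, ∀ x ∈ Ici (1 : ℝ), |f x| ≤ C * x ^ m' := by
    rintro f m m' hm ⟨C, hC⟩
    have hC0 : 0 ≤ C := by simpa using (abs_nonneg _).trans (hC 1 self_mem_Ici)
    refine ⟨C, fun x hx => (hC x hx).trans ?_⟩
    exact mul_le_mul_of_nonneg_left (Real.rpow_le_rpow_of_exponent_le hx hm) hC0
  induction n generalizing m m' f with
  | zero => exact ⟨key hm hf.1, hf.2⟩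
  | succ n ih =>
    obtain ⟨hb, g, hg, hgs⟩ := hf
    exact ⟨key hm hb, g, hg, ih hgs (by linarith)⟩

theorem const_mul_rpow (n : ℕ) (c m : ℝ) : IsSymbolUpTo n m (fun x => c * x ^ m) := by
  have key : ∀ c m : ℝ, ∃ C, ∀ x ∈ Ici (1 : ℝ), |c * x ^ m| ≤ C * x ^ m := by
    refine fun c m => ⟨|c|, fun x hx => ?_⟩
    rw [abs_mul, abs_of_nonneg (Real.rpow_nonneg (zero_le_one.trans hx) m)]
  have hder : ∀ c m : ℝ, ∀ x ∈ Ici (1 : ℝ),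
      HasDerivWithinAt (fun x : ℝ => c * x ^ m) (c * m * x ^ (m - 1)) (Ici 1) x := by
    intro c m x hx
    have hx0 : x ≠ 0 := (zero_lt_one.trans_le hx).ne'
    simpa [mul_assoc] using
      ((Real.hasDerivAt_rpow_const (p := m) (Or.inl hx0)).const_mul c).hasDerivWithinAt
  induction n generalizing c m with
  | zero => exact ⟨key c m, fun x hx => (hder c m x hx).continuousWithinAt⟩
  | succ n ih => exact ⟨key c m, _, hder c m, ih _ _⟩

theorem const (n : ℕ) (c : ℝ) : IsSymbolUpTo n 0 (fun _ => c) := by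
  simpa using const_mul_rpow n c 0

theorem contDiffOn (hf : IsSymbolUpTo n m f) : ContDiffOn ℝ n f (Ici 1) := by
  induction n generalizing m f with
  | zero => simpa using hf.2
  | succ n ih =>
    obtain ⟨-, g, hg, hgs⟩ := hf
    rw [Nat.cast_add, Nat.cast_one, contDiffOn_succ_iff_derivWithin (uniqueDiffOn_Ici 1)]
    refine ⟨fun x hx => (hg x hx).differentiableWithinAt, by simp, (ih hgs).congr fun x hx => ?_⟩
    exact (hg x hx).derivWithin (uniqueDiffOn_Ici 1 x hx)

theorem exists_iteratedDerivWithin_bound (hf : IsSymbolUpTo n m f) :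
    ∃ C, ∀ x ∈ Ici (1 : ℝ), |iteratedDerivWithin n f (Ici 1) x| ≤ C * x ^ (m - n) := by
  induction n generalizing m f with
  | zero => simpa using hf.1
  | succ n ih =>
    obtain ⟨-, g, hg, hgs⟩ := hf
    obtain ⟨C, hC⟩ := ih hgs
    refine ⟨C, fun x hx => ?_⟩
    have hder : EqOn (derivWithin f (Ici 1)) g (Ici 1) :=
      fun y hy => (hg y hy).derivWithin (uniqueDiffOn_Ici 1 y hy)
    rw [iteratedDerivWithin_succ', iteratedDerivWithin_congr hder hx]
    convert hC x hx using 3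
    push_cast
    ring

theorem of_iteratedDerivWithin (hf : ContDiffOn ℝ (⊤ : ℕ∞) f (Ici 1))
    (hb : ∀ k : ℕ, ∃ C, ∀ x ∈ Ici (1 : ℝ),
      |iteratedDerivWithin k f (Ici 1) x| ≤ C * x ^ (m - k)) (n : ℕ) :
    IsSymbolUpTo n m f := by
  induction n generalizing m f with
  | zero => exact ⟨by simpa using hb 0, hf.continuousOn⟩
  | succ n ih =>
    refine ⟨by simpa using hb 0, derivWithin f (Ici 1), fun x hx =>
      ((hf.differentiableOn (by simp)) x hx).hasDerivWithinAt,
      ih (hf.derivWithin (uniqueDiffOn_Ici 1) (by simp)) fun k => ?_⟩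
    obtain ⟨C, hC⟩ := hb (k + 1)
    refine ⟨C, fun x hx => ?_⟩
    rw [← iteratedDerivWithin_succ']
    convert hC x hx using 3
    push_cast
    ring

end IsSymbolUpTo

theorem ContinuousOn.integrableOn_Ioi_of_abs_le_rpow {g : ℝ → ℝ} {C s : ℝ} (hs : s < -1)
    (hg : ContinuousOn g (Ici 1)) (hb : ∀ y ∈ Ici (1 : ℝ), |g y| ≤ C * y ^ s) :
    IntegrableOn g (Ioi 1) := by
  refine Integrable.mono' ((integrableOn_Ioi_rpow_of_lt hs zero_lt_one).const_mul C)
    ((hg.mono Ioi_subset_Ici_self).aestronglyMeasurable measurableSet_Ioi) ?_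
  filter_upwards [ae_restrict_mem measurableSet_Ioi] with y hy
  exact hb y (mem_Ioi.1 hy).le

theorem hasDerivWithinAt_integral_Ioi {g : ℝ → ℝ} (hg : ContinuousOn g (Ici 1))
    (hi : IntegrableOn g (Ioi 1)) {x : ℝ} (hx : x ∈ Ici (1 : ℝ)) :
    HasDerivWithinAt (fun x => ∫ y in Ioi x, g y) (-g x) (Ici 1) x := by
  have hG : Continuous fun y => g (max 1 y) :=
    hg.comp_continuous (continuous_const.max continuous_id) fun y => mem_Ici.2 (le_max_left _ _)
  have h := ((hG.integral_hasStrictDerivAt 1 x).hasDerivAt.const_sub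
    (∫ y in Ioi 1, g y)).hasDerivWithinAt (s := Ici 1)
  rw [max_eq_right (mem_Ici.1 hx)] at h
  have heq : ∀ z ∈ Ici (1 : ℝ),
      ∫ y in Ioi z, g y = (∫ y in Ioi 1, g y) - ∫ y in (1 : ℝ)..z, g (max 1 y) := by
    intro z hz
    have : ∫ y in (1 : ℝ)..z, g (max 1 y) = ∫ y in (1 : ℝ)..z, g y := by
      refine intervalIntegral.integral_congr fun y hy => ?_
      rw [uIcc_of_le (mem_Ici.1 hz)] at hy
      simp [max_eq_right hy.1]
    rw [this, ← intervalIntegral.integral_Ioi_sub_Ioi hi hz]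
    ring
  exact h.congr heq (heq x hx)

/-- The solution operator, by variation of constants, of `a'' - (2ℓ/x) a' = h` with `a` decaying at
infinity. -/
noncomputable def recessiveVolterra (ℓ : ℕ) (h : ℝ → ℝ) (x : ℝ) : ℝ :=
  ∫ y in Ioi x, (y - x ^ (2 * ℓ + 1) / y ^ (2 * ℓ)) / (2 * ℓ + 1) * h y

section RecessiveVolterra

variable {ℓ : ℕ} {ε D : ℝ} {h : ℝ → ℝ}

theorem abs_recessive_kernel_mul_le {x y : ℝ} (hx : 0 ≤ x) (hxy : x < y) (c : ℝ) :
    |(y - x ^ (2 * ℓ + 1) / y ^ (2 * ℓ)) / (2 * ℓ + 1) * c| ≤ y * |c| := by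
  have hy : 0 < y := hx.trans_lt hxy
  rw [abs_mul]
  refine mul_le_mul_of_nonneg_right ?_ (abs_nonneg c)
  have h1 : x ^ (2 * ℓ + 1) / y ^ (2 * ℓ) ≤ y := by
    rw [div_le_iff₀ (by positivity), ← pow_succ']
    exact pow_le_pow_left₀ hx hxy.le _
  have h2 : 0 ≤ x ^ (2 * ℓ + 1) / y ^ (2 * ℓ) := by positivity
  rw [abs_of_nonneg (div_nonneg (by linarith) (by positivity)), div_le_iff₀ (by positivity)]
  nlinarith [mul_nonneg hy.le (Nat.cast_nonneg (α := ℝ) ℓ)]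

theorem abs_recessiveVolterra_le {b : ℝ → ℝ} {x : ℝ} (hx : 0 ≤ x) (hb : IntegrableOn b (Ioi x))
    (hh : ∀ y ∈ Ioi x, y * |h y| ≤ b y) : |recessiveVolterra ℓ h x| ≤ ∫ y in Ioi x, b y := by
  rw [← Real.norm_eq_abs]
  refine norm_integral_le_of_norm_le hb ?_
  filter_upwards [ae_restrict_mem measurableSet_Ioi] with y hy
  exact (abs_recessive_kernel_mul_le hx hy _).trans (hh y hy)

theorem abs_id_mul_le_rpow (hb : ∀ y ∈ Ici (1 : ℝ), |h y| ≤ D * y ^ (-3 + ε)) :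
    ∀ y ∈ Ici (1 : ℝ), |y * h y| ≤ D * y ^ (-2 + ε) := by
  intro y hy
  have hy0 : (0 : ℝ) < y := zero_lt_one.trans_le hy
  rw [abs_mul, abs_of_pos hy0, show -2 + ε = -3 + ε + 1 by ring, Real.rpow_add_one hy0.ne']
  nlinarith [mul_le_mul_of_nonneg_left (hb y hy) hy0.le]

theorem abs_div_pow_le_rpow (hb : ∀ y ∈ Ici (1 : ℝ), |h y| ≤ D * y ^ (-3 + ε)) :
    ∀ y ∈ Ici (1 : ℝ), |h y / y ^ (2 * ℓ)| ≤ D * y ^ (-3 + ε - (2 * ℓ : ℕ)) := by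
  intro y hy
  have hy0 : (0 : ℝ) < y := zero_lt_one.trans_le hy
  rw [abs_div, abs_of_pos (pow_pos hy0 _), Real.rpow_sub_natCast hy0.ne', ← mul_div_assoc]
  exact div_le_div_of_nonneg_right (hb y hy) (by positivity)

theorem integrableOn_id_mul (hε : ε < 1) (hh : ContinuousOn h (Ici 1))
    (hb : ∀ y ∈ Ici (1 : ℝ), |h y| ≤ D * y ^ (-3 + ε)) :
    IntegrableOn (fun y => y * h y) (Ioi 1) :=
  (continuousOn_id.mul hh).integrableOn_Ioi_of_abs_le_rpow (by linarith) (abs_id_mul_le_rpow hb)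

theorem continuousOn_div_pow (hh : ContinuousOn h (Ici 1)) :
    ContinuousOn (fun y => h y / y ^ (2 * ℓ)) (Ici 1) :=
  hh.div (by fun_prop) fun _ hy => (pow_pos (zero_lt_one.trans_le (mem_Ici.1 hy)) _).ne'

theorem integrableOn_div_pow (hε : ε < 1) (hh : ContinuousOn h (Ici 1))
    (hb : ∀ y ∈ Ici (1 : ℝ), |h y| ≤ D * y ^ (-3 + ε)) :
    IntegrableOn (fun y => h y / y ^ (2 * ℓ)) (Ioi 1) :=
  (continuousOn_div_pow hh).integrableOn_Ioi_of_abs_le_rpow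
    (by have : (0 : ℝ) ≤ (2 * ℓ : ℕ) := Nat.cast_nonneg _
        linarith) (abs_div_pow_le_rpow hb)

theorem recessiveVolterra_eq (hε : ε < 1) (hh : ContinuousOn h (Ici 1))
    (hb : ∀ y ∈ Ici (1 : ℝ), |h y| ≤ D * y ^ (-3 + ε)) {x : ℝ} (hx : x ∈ Ici (1 : ℝ)) :
    recessiveVolterra ℓ h x = (2 * ℓ + 1 : ℝ)⁻¹ *
      ((∫ y in Ioi x, y * h y) - x ^ (2 * ℓ + 1) * ∫ y in Ioi x, h y / y ^ (2 * ℓ)) := by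
  have h1 := (integrableOn_id_mul hε hh hb).mono_set (Ioi_subset_Ioi hx)
  have h2 := (integrableOn_div_pow (ℓ := ℓ) hε hh hb).mono_set (Ioi_subset_Ioi hx)
  rw [← integral_const_mul, ← integral_sub h1 (h2.const_mul _), ← integral_const_mul]
  refine integral_congr_ae (Eventually.of_forall fun y => ?_)
  simp only [div_eq_mul_inv]
  ring

theorem hasDerivWithinAt_recessiveVolterra (hε : ε < 1) (hh : ContinuousOn h (Ici 1))
    (hb : ∀ y ∈ Ici (1 : ℝ), |h y| ≤ D * y ^ (-3 + ε)) {x : ℝ} (hx : x ∈ Ici (1 : ℝ)) :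
    HasDerivWithinAt (recessiveVolterra ℓ h)
      (-(x ^ (2 * ℓ) * ∫ y in Ioi x, h y / y ^ (2 * ℓ))) (Ici 1) x := by
  have hx0 : x ≠ 0 := (zero_lt_one.trans_le (mem_Ici.1 hx)).ne'
  have h1 := hasDerivWithinAt_integral_Ioi (continuousOn_id.mul hh)
    (integrableOn_id_mul hε hh hb) hx
  have h2 := hasDerivWithinAt_integral_Ioi (continuousOn_div_pow (ℓ := ℓ) hh)
    (integrableOn_div_pow hε hh hb) hx
  have h3 := (h1.sub (((hasDerivAt_pow (2 * ℓ + 1) x).hasDerivWithinAt).mul h2)).const_mul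
    (2 * ℓ + 1 : ℝ)⁻¹
  refine (h3.congr (fun z hz => recessiveVolterra_eq hε hh hb hz)
    (recessiveVolterra_eq hε hh hb hx)).congr_deriv ?_
  have hl : (2 * ℓ + 1 : ℝ) ≠ 0 := by positivity
  simp only [id, Pi.mul_apply, add_tsub_cancel_right]
  push_cast
  field_simp
  ring

theorem hasDerivWithinAt_deriv_recessiveVolterra (hε : ε < 1) (hh : ContinuousOn h (Ici 1))
    (hb : ∀ y ∈ Ici (1 : ℝ), |h y| ≤ D * y ^ (-3 + ε)) {x : ℝ} (hx : x ∈ Ici (1 : ℝ)) :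
    HasDerivWithinAt (fun x => -(x ^ (2 * ℓ) * ∫ y in Ioi x, h y / y ^ (2 * ℓ)))
      (2 * ℓ / x * -(x ^ (2 * ℓ) * ∫ y in Ioi x, h y / y ^ (2 * ℓ)) + h x) (Ici 1) x := by
  have hx0 : x ≠ 0 := (zero_lt_one.trans_le (mem_Ici.1 hx)).ne'
  have h2 := hasDerivWithinAt_integral_Ioi (continuousOn_div_pow (ℓ := ℓ) hh)
    (integrableOn_div_pow hε hh hb) hx
  refine (((hasDerivAt_pow (2 * ℓ) x).hasDerivWithinAt).mul h2).neg.congr_deriv ?_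
  rcases Nat.eq_zero_or_pos ℓ with rfl | hl
  · simp
  · obtain ⟨k, hk⟩ : ∃ k, 2 * ℓ = k + 1 := ⟨2 * ℓ - 1, by omega⟩
    have hk' : (2 * ℓ : ℝ) = k + 1 := by exact_mod_cast hk
    rw [hk, hk']
    push_cast
    field_simp
    ring

theorem abs_recessiveVolterra_le_rpow (hε : ε < 1)
    (hb : ∀ y ∈ Ici (1 : ℝ), |h y| ≤ D * y ^ (-3 + ε)) {x : ℝ} (hx : x ∈ Ici (1 : ℝ)) :
    |recessiveVolterra ℓ h x| ≤ D / (1 - ε) * x ^ (-1 + ε) := by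
  have hx0 : (0 : ℝ) < x := zero_lt_one.trans_le hx
  have hs : -2 + ε < -1 := by linarith
  refine (abs_recessiveVolterra_le hx0.le ((integrableOn_Ioi_rpow_of_lt hs hx0).const_mul D)
    fun y hy => ?_).trans_eq ?_
  · have hy1 : y ∈ Ici (1 : ℝ) := (mem_Ici.1 hx).trans (mem_Ioi.1 hy).le
    simpa [abs_mul, abs_of_pos (zero_lt_one.trans_le (mem_Ici.1 hy1))] using
      abs_id_mul_le_rpow hb y hy1
  · rw [integral_const_mul, integral_Ioi_rpow_of_lt hs hx0, show -2 + ε + 1 = -(1 - ε) by ring,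
      neg_div_neg_eq, show -(1 - ε) = -1 + ε by ring]
    ring

theorem abs_deriv_recessiveVolterra_le_rpow (hε : ε < 1)
    (hb : ∀ y ∈ Ici (1 : ℝ), |h y| ≤ D * y ^ (-3 + ε)) {x : ℝ} (hx : x ∈ Ici (1 : ℝ)) :
    |-(x ^ (2 * ℓ) * ∫ y in Ioi x, h y / y ^ (2 * ℓ))| ≤
      D / (2 * ℓ + 2 - ε) * x ^ (-2 + ε) := by
  have hx0 : (0 : ℝ) < x := zero_lt_one.trans_le hx
  have hl : (0 : ℝ) ≤ (2 * ℓ : ℕ) := Nat.cast_nonneg _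
  have hs : -3 + ε - (2 * ℓ : ℕ) < -1 := by linarith
  have h1 : |∫ y in Ioi x, h y / y ^ (2 * ℓ)| ≤ ∫ y in Ioi x, D * y ^ (-3 + ε - (2 * ℓ : ℕ)) := by
    rw [← Real.norm_eq_abs]
    refine norm_integral_le_of_norm_le ((integrableOn_Ioi_rpow_of_lt hs hx0).const_mul D) ?_
    filter_upwards [ae_restrict_mem measurableSet_Ioi] with y hy
    exact abs_div_pow_le_rpow hb y ((mem_Ici.1 hx).trans (mem_Ioi.1 hy).le)
  rw [integral_const_mul, integral_Ioi_rpow_of_lt hs hx0,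
    show -3 + ε - (2 * ℓ : ℕ) + 1 = -2 + ε - (2 * ℓ : ℕ) by ring,
    Real.rpow_sub_natCast hx0.ne'] at h1
  rw [abs_neg, abs_mul, abs_of_pos (pow_pos hx0 _)]
  refine (mul_le_mul_of_nonneg_left h1 (pow_pos hx0 _).le).trans_eq ?_
  have hx1 : x ^ (2 * ℓ) ≠ 0 := (pow_pos hx0 _).ne'
  rw [show -2 + ε - (2 * ℓ : ℕ) = -(2 * ℓ + 2 - ε) by push_cast; ring, neg_div_neg_eq]
  push_cast at hl
  have hd : (2 * ℓ + 2 - ε : ℝ) ≠ 0 := by linarith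
  field_simp

theorem integrableOn_recessive_kernel_mul (hε : ε < 1) (hh : ContinuousOn h (Ici 1))
    (hb : ∀ y ∈ Ici (1 : ℝ), |h y| ≤ D * y ^ (-3 + ε)) {x : ℝ} (hx : x ∈ Ici (1 : ℝ)) :
    IntegrableOn (fun y => (y - x ^ (2 * ℓ + 1) / y ^ (2 * ℓ)) / (2 * ℓ + 1) * h y) (Ioi x) := by
  have hc : ContinuousOn (fun y => (y - x ^ (2 * ℓ + 1) / y ^ (2 * ℓ)) / (2 * ℓ + 1) * h y)
      (Ici 1) :=
    ((continuousOn_id.sub (continuousOn_div_pow continuousOn_const)).div_const _).mul hh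
  refine Integrable.mono' ((integrableOn_id_mul hε hh hb).mono_set (Ioi_subset_Ioi hx)).norm
    ((hc.mono ((Ioi_subset_Ioi hx).trans Ioi_subset_Ici_self)).aestronglyMeasurable
      measurableSet_Ioi) ?_
  filter_upwards [ae_restrict_mem measurableSet_Ioi] with y hy
  have hx0 : (0 : ℝ) < x := zero_lt_one.trans_le hx
  refine (abs_recessive_kernel_mul_le hx0.le hy (h y)).trans_eq ?_
  rw [norm_mul, Real.norm_of_nonneg (hx0.trans hy).le, Real.norm_eq_abs]

theorem recessiveVolterra_sub {D' : ℝ} {g : ℝ → ℝ} (hε : ε < 1) (hh : ContinuousOn h (Ici 1))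
    (hb : ∀ y ∈ Ici (1 : ℝ), |h y| ≤ D * y ^ (-3 + ε)) (hg : ContinuousOn g (Ici 1))
    (hb' : ∀ y ∈ Ici (1 : ℝ), |g y| ≤ D' * y ^ (-3 + ε)) {x : ℝ} (hx : x ∈ Ici (1 : ℝ)) :
    recessiveVolterra ℓ h x - recessiveVolterra ℓ g x =
      recessiveVolterra ℓ (fun y => h y - g y) x := by
  simp only [recessiveVolterra, mul_sub]
  exact (integral_sub (integrableOn_recessive_kernel_mul hε hh hb hx)
    (integrableOn_recessive_kernel_mul hε hg hb' hx)).symm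

end RecessiveVolterra

theorem exp_rpow_weight_tail_integral {C ε : ℝ} (hC : 0 ≤ C) (hε : ε < 1) {x : ℝ} (hx : 0 < x) :
    IntegrableOn (fun y => C * y ^ (-2 + ε) * Real.exp (2 * C / (1 - ε) * y ^ (-1 + ε))) (Ioi x) ∧
      ∫ y in Ioi x, C * y ^ (-2 + ε) * Real.exp (2 * C / (1 - ε) * y ^ (-1 + ε)) =
        (Real.exp (2 * C / (1 - ε) * x ^ (-1 + ε)) - 1) / 2 := by
  have hε' : 1 - ε ≠ 0 := by linarith
  have hder : ∀ y ∈ Ici x,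
      HasDerivAt (fun y => -(1 / 2) * Real.exp (2 * C / (1 - ε) * y ^ (-1 + ε)))
        (C * y ^ (-2 + ε) * Real.exp (2 * C / (1 - ε) * y ^ (-1 + ε))) y := by
    intro y hy
    have hy0 : y ≠ 0 := (hx.trans_le hy).ne'
    refine ((((Real.hasDerivAt_rpow_const (p := -1 + ε) (Or.inl hy0)).const_mul
      (2 * C / (1 - ε))).exp).const_mul (-(1 / 2))).congr_deriv ?_
    rw [show -1 + ε - 1 = -2 + ε by ring]
    field_simp
    ring
  have hlim : Tendsto (fun y => -(1 / 2) * Real.exp (2 * C / (1 - ε) * y ^ (-1 + ε))) atTop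
      (𝓝 (-(1 / 2))) := by
    have h0 : Tendsto (fun y : ℝ => y ^ (-1 + ε)) atTop (𝓝 0) := by
      simpa [show -(1 - ε) = -1 + ε by ring] using
        tendsto_rpow_neg_atTop (show 0 < 1 - ε by linarith)
    have h1 := ((Real.continuous_exp.tendsto _).comp
      (h0.const_mul (2 * C / (1 - ε)))).const_mul (-(1 / 2))
    simpa using h1
  have hint := integrableOn_Ioi_deriv_of_nonneg' hder (fun y hy => by
    have hy0 : 0 ≤ y := (hx.trans (mem_Ioi.1 hy)).le
    positivity) hlim
  refine ⟨hint, ?_⟩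
  rw [integral_Ioi_of_hasDerivAt_of_tendsto' hder hint hlim]
  ring

theorem exists_eq_recessiveVolterra (ℓ : ℕ) {W : ℝ → ℝ} {C ε : ℝ} (hε : ε < 1)
    (hW : ContinuousOn W (Ici 1)) (hb : ∀ y ∈ Ici (1 : ℝ), |W y| ≤ C * y ^ (-3 + ε)) :
    ∃ a : ℝ → ℝ, ContinuousOn a (Ici 1) ∧ (∃ B, ∀ x ∈ Ici (1 : ℝ), |a x| ≤ B) ∧
      ∀ x ∈ Ici (1 : ℝ), a x = recessiveVolterra ℓ (fun y => W y * (1 + a y)) x := by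
  have hC : 0 ≤ C := by simpa using (abs_nonneg _).trans (hb 1 self_mem_Ici)
  have hδ : 0 < 1 - ε := by linarith
  set κ : ℝ := 2 * C / (1 - ε)
  have hκ0 : 0 ≤ κ := by positivity
  let w : ℝ → ℝ := fun y => Real.exp (κ * y ^ (-1 + ε))
  have hw0 : ∀ y, 0 < w y := fun y => Real.exp_pos _
  have hw1 : ∀ y ∈ Ici (1 : ℝ), 1 ≤ w y := fun y hy => Real.one_le_exp <|
    mul_nonneg hκ0 (Real.rpow_nonneg (zero_le_one.trans hy) _)
  have hwκ : ∀ y ∈ Ici (1 : ℝ), w y ≤ Real.exp κ := fun y hy => Real.exp_le_exp.2 <|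
    mul_le_of_le_one_right hκ0 (Real.rpow_le_one_of_one_le_of_nonpos hy (by linarith))
  have hwc : ContinuousOn w (Ici 1) := Real.continuous_exp.comp_continuousOn <|
    continuousOn_const.mul <| continuousOn_id.rpow_const fun y hy =>
      Or.inl (zero_lt_one.trans_le (mem_Ici.1 hy)).ne'
  let H : (ℝ →ᵇ ℝ) → ℝ → ℝ := fun f y => W y * (1 + w y * f y)
  have hac : ∀ f : ℝ →ᵇ ℝ, ContinuousOn (fun y => w y * f y) (Ici 1) :=
    fun f => hwc.mul f.continuous.continuousOn
  have hab : ∀ f : ℝ →ᵇ ℝ, ∀ y ∈ Ici (1 : ℝ), |w y * f y| ≤ Real.exp κ * ‖f‖ := by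
    intro f y hy
    rw [abs_mul, abs_of_pos (hw0 y)]
    exact mul_le_mul (hwκ y hy) (f.norm_coe_le_norm y) (abs_nonneg _) (Real.exp_pos _).le
  have hHc : ∀ f, ContinuousOn (H f) (Ici 1) := fun f =>
    hW.mul (continuousOn_const.add (hac f))
  have hHb : ∀ f, ∀ y ∈ Ici (1 : ℝ),
      |H f y| ≤ C * (1 + Real.exp κ * ‖f‖) * y ^ (-3 + ε) := by
    intro f y hy
    rw [abs_mul, mul_right_comm]
    refine mul_le_mul (hb y hy) ((abs_add_le _ _).trans ?_) (abs_nonneg _)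
      ((abs_nonneg _).trans (hb y hy))
    rw [abs_one]
    linarith [hab f y hy]
  have hmax : ∀ x : ℝ, max 1 x ∈ Ici (1 : ℝ) := fun x => mem_Ici.2 (le_max_left _ _)
  let T : (ℝ →ᵇ ℝ) → (ℝ →ᵇ ℝ) := fun f =>
    BoundedContinuousFunction.ofNormedAddCommGroup
      (fun x => recessiveVolterra ℓ (H f) (max 1 x) / w (max 1 x))
      (ContinuousOn.comp_continuous (f := fun x => max 1 x)
        (g := fun x => recessiveVolterra ℓ (H f) x / w x) (s := Ici 1)
        (ContinuousOn.div (fun x hx =>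
          (hasDerivWithinAt_recessiveVolterra hε (hHc f) (hHb f) hx).continuousWithinAt)
          hwc fun x _ => (hw0 x).ne')
        (continuous_const.max continuous_id) hmax)
      (C * (1 + Real.exp κ * ‖f‖) / (1 - ε)) (fun x => by
        have hx := hmax x
        have h1 := abs_recessiveVolterra_le_rpow (ℓ := ℓ) hε (hHb f) hx
        rw [Real.norm_eq_abs, abs_div, abs_of_pos (hw0 _)]
        refine (div_le_self (abs_nonneg _) (hw1 _ hx)).trans (h1.trans ?_)
        exact mul_le_of_le_one_right (by positivity)
          (Real.rpow_le_one_of_one_le_of_nonpos hx (by linarith)))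
  have hT : ContractingWith (1 / 2) T := by
    refine ⟨by norm_num, LipschitzWith.of_dist_le_mul fun f g => ?_⟩
    refine (BoundedContinuousFunction.dist_le (by positivity)).2 fun x => ?_
    have hx := hmax x
    change |recessiveVolterra ℓ (H f) (max 1 x) / w (max 1 x) -
      recessiveVolterra ℓ (H g) (max 1 x) / w (max 1 x)| ≤ _
    generalize max 1 x = z at hx
    have hz0 : (0 : ℝ) < z := zero_lt_one.trans_le hx
    obtain ⟨hi, hval⟩ := exp_rpow_weight_tail_integral hC hε hz0
    rw [← sub_div, recessiveVolterra_sub hε (hHc f) (hHb f) (hHc g) (hHb g) hx, abs_div,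
      abs_of_pos (hw0 z), div_le_iff₀ (hw0 z)]
    refine (abs_recessiveVolterra_le hz0.le (hi.const_mul (dist f g)) fun y hy => ?_).trans ?_
    · have hy1 : y ∈ Ici (1 : ℝ) := (mem_Ici.1 hx).trans (mem_Ioi.1 hy).le
      have h1 := abs_id_mul_le_rpow hb y hy1
      have hy0 : (0 : ℝ) < y := zero_lt_one.trans_le hy1
      have h2 : |f y - g y| ≤ dist f g := f.dist_coe_le_dist y
      have h3 : H f y - H g y = W y * (w y * (f y - g y)) := by
        simp only [H]
        ring
      rw [abs_mul, abs_of_pos hy0] at h1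
      rw [h3, abs_mul, abs_mul, abs_of_pos (hw0 y)]
      calc y * (|W y| * (w y * |f y - g y|)) = y * |W y| * w y * |f y - g y| := by ring
        _ ≤ C * y ^ (-2 + ε) * w y * dist f g :=
          mul_le_mul (mul_le_mul_of_nonneg_right h1 (hw0 y).le) h2 (abs_nonneg _)
            (mul_nonneg (by positivity) (hw0 y).le)
        _ = _ := mul_comm _ _
    · rw [integral_const_mul, hval]
      have h4 : (0 : ℝ) ≤ dist f g := dist_nonneg
      have h5 : Real.exp (2 * C / (1 - ε) * z ^ (-1 + ε)) = w z := rfl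
      rw [h5]
      push_cast
      linarith
  set f := ContractingWith.fixedPoint T hT
  have hf : T f = f := hT.fixedPoint_isFixedPt
  refine ⟨fun y => w y * f y, hac f, ⟨_, hab f⟩, fun x hx => ?_⟩
  have h1 : f x = recessiveVolterra ℓ (H f) (max 1 x) / w (max 1 x) :=
    (DFunLike.congr_fun hf x).symm
  rw [max_eq_right (mem_Ici.1 hx)] at h1
  rw [eq_div_iff (hw0 x).ne', mul_comm] at h1
  exact h1

/-- Existence of the recessive zero-energy solution `u₁(x) = x^{−ℓ}(1 + a(x))` of
`−u'' + Vu = 0` on `[1,∞)` when `V(x) = ℓ(ℓ+1)/x² + O(x^{−3+ε})` with symbol-type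
error; the correction `a` satisfies `|a^{(k)}(x)| ≤ C_k x^{−1+ε−k}` for all `k`. -/
theorem zero_energy_recessive_solution
    (ℓ : ℕ) (hℓ : 1 ≤ ℓ) (ε : ℝ) (hε : ε ∈ Set.Ioo (0 : ℝ) 1)
    (V : ℝ → ℝ) (hV : ContDiffOn ℝ (⊤ : ℕ∞) V (Set.Ici 1))
    (CV : ℕ → ℝ)
    (hVsym : ∀ k : ℕ, ∀ x ∈ Set.Ici (1 : ℝ),
      |iteratedDerivWithin k (fun y => V y - (ℓ * (ℓ + 1) : ℝ) / y ^ 2) (Set.Ici 1) x| ≤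
        CV k * x ^ (-3 + ε - k)) :
    ∃ u₁ a : ℝ → ℝ,
      ContDiffOn ℝ (⊤ : ℕ∞) u₁ (Set.Ici 1) ∧
      (∀ x ∈ Set.Ici (1 : ℝ), u₁ x = x ^ (-(ℓ : ℝ)) * (1 + a x)) ∧
      (∀ x ∈ Set.Ici (1 : ℝ),
        derivWithin (derivWithin u₁ (Set.Ici 1)) (Set.Ici 1) x = V x * u₁ x) ∧
      (∀ k : ℕ, ∃ C : ℝ, ∀ x ∈ Set.Ici (1 : ℝ),
        |iteratedDerivWithin k a (Set.Ici 1) x| ≤ C * x ^ (-1 + ε - k)) := by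
  obtain ⟨-, hε1⟩ := hε
  set W : ℝ → ℝ := fun y => V y - (ℓ * (ℓ + 1) : ℝ) / y ^ 2 with hWdef
  have hWs : ContDiffOn ℝ (⊤ : ℕ∞) W (Ici 1) := hV.sub <| contDiffOn_const.div (by fun_prop)
    fun y hy => pow_ne_zero 2 (zero_lt_one.trans_le (mem_Ici.1 hy)).ne'
  have hWsym : ∀ n, IsSymbolUpTo n (-3 + ε) W :=
    IsSymbolUpTo.of_iteratedDerivWithin hWs fun k => ⟨CV k, hVsym k⟩
  have hWb : ∀ y ∈ Ici (1 : ℝ), |W y| ≤ CV 0 * y ^ (-3 + ε) := by simpa using hVsym 0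
  obtain ⟨a, hac, ⟨B, hB⟩, ha⟩ := exists_eq_recessiveVolterra ℓ hε1 hWs.continuousOn hWb
  set h : ℝ → ℝ := fun y => W y * (1 + a y)
  have hhc : ContinuousOn h (Ici 1) := hWs.continuousOn.mul (continuousOn_const.add hac)
  have hhb : ∀ y ∈ Ici (1 : ℝ), |h y| ≤ CV 0 * (1 + B) * y ^ (-3 + ε) := by
    intro y hy
    rw [abs_mul, mul_right_comm]
    refine mul_le_mul (hWb y hy) ((abs_add_le _ _).trans ?_) (abs_nonneg _)
      ((abs_nonneg _).trans (hWb y hy))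
    rw [abs_one]
    linarith [hB y hy]
  set a' : ℝ → ℝ := fun x => -(x ^ (2 * ℓ) * ∫ y in Ioi x, h y / y ^ (2 * ℓ))
  have hder : ∀ x ∈ Ici (1 : ℝ), HasDerivWithinAt a (a' x) (Ici 1) x := fun x hx =>
    (hasDerivWithinAt_recessiveVolterra hε1 hhc hhb hx).congr ha (ha x hx)
  have hder' : ∀ x ∈ Ici (1 : ℝ),
      HasDerivWithinAt a' (2 * ℓ / x * a' x + W x * (1 + a x)) (Ici 1) x := fun x hx =>
    hasDerivWithinAt_deriv_recessiveVolterra hε1 hhc hhb hx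
  have hab : ∃ C, ∀ x ∈ Ici (1 : ℝ), |a x| ≤ C * x ^ (-1 + ε) := ⟨_, fun x hx => by
    rw [ha x hx]
    exact abs_recessiveVolterra_le_rpow hε1 hhb hx⟩
  have hab' : ∃ C, ∀ x ∈ Ici (1 : ℝ), |a' x| ≤ C * x ^ (-2 + ε) :=
    ⟨_, fun x hx => abs_deriv_recessiveVolterra_le_rpow hε1 hhb hx⟩
  have hsym : ∀ n, IsSymbolUpTo n (-1 + ε) a ∧ IsSymbolUpTo n (-2 + ε) a' := by
    intro n
    induction n with
    | zero => exact ⟨⟨hab, hac⟩, hab', fun x hx => (hder' x hx).continuousWithinAt⟩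
    | succ n ih =>
      refine ⟨⟨hab, a', hder, ?_⟩, hab', fun x => 2 * ℓ * x ^ (-1 : ℝ) * a' x + W x * (1 + a x),
        fun x hx => ?_, IsSymbolUpTo.add ?_ ?_⟩
      · convert ih.2 using 1
        ring
      · beta_reduce
        rw [Real.rpow_neg_one, ← div_eq_mul_inv]
        exact hder' x hx
      · convert (IsSymbolUpTo.const_mul_rpow n (2 * ℓ) (-1)).mul ih.2 using 1
        ring
      · convert (hWsym n).mul
          ((IsSymbolUpTo.const n 1).add (ih.1.mono (by linarith))) using 1
        ring
  have hasm : ContDiffOn ℝ (⊤ : ℕ∞) a (Ici 1) :=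
    contDiffOn_infty.2 fun n => (hsym n).1.contDiffOn
  have hpow : ∀ c : ℝ, ∀ x ∈ Ici (1 : ℝ),
      HasDerivWithinAt (fun x : ℝ => x ^ c) (c * x ^ (c - 1)) (Ici 1) x := fun c x hx =>
    (Real.hasDerivAt_rpow_const (Or.inl (zero_lt_one.trans_le (mem_Ici.1 hx)).ne')).hasDerivWithinAt
  have hud := uniqueDiffOn_Ici (1 : ℝ)
  refine ⟨fun x => x ^ (-(ℓ : ℝ)) * (1 + a x), a, ?_, fun x _ => rfl, fun x hx => ?_,
    fun k => (hsym k).1.exists_iteratedDerivWithin_bound⟩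
  · exact ContDiffOn.mul (contDiffOn_id.rpow_const_of_ne fun x hx =>
      (zero_lt_one.trans_le (mem_Ici.1 hx)).ne') (contDiffOn_const.add hasm)
  · have hx0 : x ≠ 0 := (zero_lt_one.trans_le (mem_Ici.1 hx)).ne'
    have h1 : EqOn (derivWithin (fun x => x ^ (-(ℓ : ℝ)) * (1 + a x)) (Ici 1))
        (fun x => -ℓ * x ^ (-(ℓ : ℝ) - 1) * (1 + a x) + x ^ (-(ℓ : ℝ)) * a' x) (Ici 1) :=
      fun y hy => ((hpow _ y hy).mul ((hder y hy).const_add 1)).derivWithin (hud y hy)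
    have h2 := ((((hpow (-ℓ - 1) x hx).const_mul (-ℓ : ℝ)).mul ((hder x hx).const_add 1)).add
      ((hpow (-ℓ) x hx).mul (hder' x hx))).derivWithin (hud x hx)
    refine (derivWithin_congr h1 (h1 hx)).trans (h2.trans ?_)
    have hV' : V x = W x + ℓ * (ℓ + 1) / x ^ 2 := by simp [hWdef]
    rw [hV', Real.rpow_sub_one hx0, Real.rpow_sub_one hx0]
    field_simp
    ring
end

section
/- Let V : (−∞,−1] → ℝ be continuous with |V(x)| ≤ C e^{x/(2M)} for some constants C, M > 0. Then there exist solutions v₀, v₁ of −v'' + V v = 0 on (−∞,−1] with v₀(x) = x(1 + O(x^{−1})) and v₁(x) = 1 + O(x^{−1}) as x → −∞. They satisfy the Volterra equations v₀(x)/x = 1 − ∫_{−∞}^x (y²/x − y) V(y) (v₀(y)/y) dy and v₁(x) = 1 − ∫_{−∞}^x (y − x) V(y) v₁(y) dy. -/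
open Set Filter MeasureTheory

open scoped Topology BoundedContinuousFunction

lemma hasDerivAt_integral_Iic {h : ℝ → ℝ} (hc : Continuous h)
    (hi : ∀ b, IntegrableOn h (Iic b)) (x : ℝ) :
    HasDerivAt (fun x => ∫ y in Iic x, h y) (h x) x := by
  have e : (fun x => ∫ y in Iic x, h y) =
      fun x => (∫ y in Iic (0 : ℝ), h y) + ∫ y in (0 : ℝ)..x, h y := by
    funext z
    rw [← intervalIntegral.integral_Iic_sub_Iic (hi 0) (hi z)]
    ring
  rw [e]
  exact ((hc.integral_hasStrictDerivAt 0 x).hasDerivAt).const_add _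

lemma integral_Iic_sub_mul {h : ℝ → ℝ} (hi : ∀ b, IntegrableOn h (Iic b))
    (hi' : ∀ b, IntegrableOn (fun y => y * h y) (Iic b)) (x : ℝ) :
    ∫ y in Iic x, (x - y) * h y = x * (∫ y in Iic x, h y) - ∫ y in Iic x, y * h y := by
  rw [← integral_const_mul, ← integral_sub ((hi x).const_mul x) (hi' x)]
  congr 1
  funext y
  ring

lemma integrableOn_Iic_sub_mul {h : ℝ → ℝ} (hi : ∀ b, IntegrableOn h (Iic b))
    (hi' : ∀ b, IntegrableOn (fun y => y * h y) (Iic b)) (x : ℝ) :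
    IntegrableOn (fun y => (x - y) * h y) (Iic x) := by
  refine (((hi x).const_mul x).sub (hi' x)).congr (Eventually.of_forall fun y => ?_)
  simp only [Pi.sub_apply]
  ring

lemma hasDerivAt_integral_Iic_sub_mul {h : ℝ → ℝ} (hc : Continuous h)
    (hi : ∀ b, IntegrableOn h (Iic b))
    (hi' : ∀ b, IntegrableOn (fun y => y * h y) (Iic b)) (x : ℝ) :
    HasDerivAt (fun x => ∫ y in Iic x, (x - y) * h y) (∫ y in Iic x, h y) x := by
  rw [funext (integral_Iic_sub_mul hi hi')]
  refine (((hasDerivAt_id x).mul (hasDerivAt_integral_Iic hc hi x)).sub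
    (hasDerivAt_integral_Iic (continuous_id.mul hc) hi' x)).congr_deriv ?_
  simp

lemma integrableOn_Iic_of_exp_bound {h : ℝ → ℝ} (hc : Continuous h) {a : ℝ} (ha : 0 < a)
    (hb : ∀ b, ∃ D, ∀ y ≤ b, |h y| ≤ D * Real.exp (a * y)) (b : ℝ) :
    IntegrableOn h (Iic b) := by
  obtain ⟨D, hD⟩ := hb b
  refine Integrable.mono' ((integrableOn_exp_mul_Iic ha b).const_mul D)
    hc.aestronglyMeasurable.restrict ?_
  exact (ae_restrict_iff' measurableSet_Iic).2 (Eventually.of_forall fun y hy => hD y hy)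

/-- A weight absorbing the Volterra kernel: its logarithmic derivative is `2 * K * exp (a * x)`. -/
noncomputable def volterraWeight (K a x : ℝ) : ℝ := Real.exp (2 * K / a * Real.exp (a * x))

lemma volterraWeight_pos (K a x : ℝ) : 0 < volterraWeight K a x := Real.exp_pos _

lemma continuous_volterraWeight (K a : ℝ) : Continuous (volterraWeight K a) := by
  unfold volterraWeight
  fun_prop

lemma one_le_volterraWeight {K a : ℝ} (hK : 0 ≤ K) (ha : 0 < a) (x : ℝ) :
    1 ≤ volterraWeight K a x :=
  Real.one_le_exp (by positivity)

lemma volterraWeight_mono {K a : ℝ} (hK : 0 ≤ K) (ha : 0 < a) :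
    Monotone (volterraWeight K a) := by
  intro x y hxy
  unfold volterraWeight
  gcongr

lemma integrableOn_exp_mul_volterraWeight {K a : ℝ} (hK : 0 ≤ K) (ha : 0 < a) (b : ℝ) :
    IntegrableOn (fun y => Real.exp (a * y) * volterraWeight K a y) (Iic b) := by
  have := continuous_volterraWeight K a
  refine integrableOn_Iic_of_exp_bound (by fun_prop) ha
    (fun b => ⟨volterraWeight K a b, fun y hy => ?_⟩) b
  rw [abs_of_pos (mul_pos (Real.exp_pos _) (volterraWeight_pos _ _ _)), mul_comm]
  gcongr
  exact volterraWeight_mono hK ha hy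

lemma integral_exp_mul_volterraWeight {K a : ℝ} (hK : 0 ≤ K) (ha : 0 < a) (x : ℝ) :
    ∫ y in Iic x, 2 * K * (Real.exp (a * y) * volterraWeight K a y) =
      volterraWeight K a x - 1 := by
  refine integral_Iic_of_hasDerivAt_of_tendsto' (fun y _ => ?_)
    ((integrableOn_exp_mul_volterraWeight hK ha x).const_mul _) ?_
  · have h1 : HasDerivAt (fun y : ℝ => Real.exp (a * y)) (Real.exp (a * y) * (a * 1)) y :=
      ((hasDerivAt_id y).const_mul a).exp
    refine (h1.const_mul (2 * K / a)).exp.congr_deriv ?_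
    unfold volterraWeight
    field_simp
  · have h1 : Tendsto (fun y : ℝ => Real.exp (a * y)) atBot (𝓝 0) :=
      Real.tendsto_exp_atBot.comp (tendsto_id.const_mul_atBot ha)
    have h2 := (Real.continuous_exp.tendsto _).comp (h1.const_mul (2 * K / a))
    rw [mul_zero, Real.exp_zero] at h2
    exact h2

section Volterra

variable {W : ℝ → ℝ} {K a : ℝ}

lemma abs_mul_exp_bound (hWb : ∀ y, |W y| * (1 + |y|) ^ 2 ≤ K * Real.exp (a * y))
    {D y F P : ℝ} (hF : |F| ≤ D * (1 + |y|) * P) :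
    |W y * F| * (1 + |y|) ≤ D * (K * (Real.exp (a * y) * P)) := by
  have hD : 0 ≤ D * P := by
    have : 0 ≤ (1 + |y|) * (D * P) := by linarith [abs_nonneg F]
    exact nonneg_of_mul_nonneg_right this (by positivity)
  calc |W y * F| * (1 + |y|) = |W y| * |F| * (1 + |y|) := by rw [abs_mul]
    _ ≤ |W y| * (D * (1 + |y|) * P) * (1 + |y|) := by gcongr
    _ = D * P * (|W y| * (1 + |y|) ^ 2) := by ring
    _ ≤ D * P * (K * Real.exp (a * y)) := mul_le_mul_of_nonneg_left (hWb y) hD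
    _ = _ := by ring

variable (hK : 0 ≤ K) (ha : 0 < a)
  (hWb : ∀ y, |W y| * (1 + |y|) ^ 2 ≤ K * Real.exp (a * y))

include hK ha hWb

lemma volterra_abs_integral_le {F : ℝ → ℝ} {D : ℝ}
    (hFb : ∀ y, |F y| ≤ D * (1 + |y|) * volterraWeight K a y) (x : ℝ) :
    |∫ y in Iic x, (x - y) * (W y * F y)| ≤ D / 2 * ((1 + |x|) * volterraWeight K a x) := by
  have hD : 0 ≤ D := by
    have h0 := (abs_nonneg _).trans (hFb 0)
    simp only [abs_zero, add_zero, mul_one] at h0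
    exact nonneg_of_mul_nonneg_left h0 (volterraWeight_pos _ _ _)
  have h1 : ‖∫ y in Iic x, (x - y) * (W y * F y)‖ ≤
      ∫ y in Iic x, D / 2 * (1 + |x|) *
        (2 * K * (Real.exp (a * y) * volterraWeight K a y)) := by
    refine norm_integral_le_of_norm_le
      (((integrableOn_exp_mul_volterraWeight hK ha x).const_mul _).const_mul _)
      (Eventually.of_forall fun y => ?_)
    have h2 := abs_mul_exp_bound hWb (hFb y)
    have h3 : |x - y| ≤ (1 + |x|) * (1 + |y|) := by
      nlinarith [abs_sub x y, abs_nonneg x, abs_nonneg y, mul_nonneg (abs_nonneg x) (abs_nonneg y)]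
    rw [Real.norm_eq_abs, abs_mul]
    calc |x - y| * |W y * F y| ≤ (1 + |x|) * (1 + |y|) * |W y * F y| := by gcongr
      _ = (1 + |x|) * (|W y * F y| * (1 + |y|)) := by ring
      _ ≤ (1 + |x|) * (D * (K * (Real.exp (a * y) * volterraWeight K a y))) := by gcongr
      _ = _ := by ring
  rw [integral_const_mul, integral_exp_mul_volterraWeight hK ha] at h1
  refine h1.trans ?_
  rw [← mul_assoc]
  gcongr
  linarith

lemma volterra_abs_integral_le_exp {F : ℝ → ℝ} {D : ℝ}
    (hFb : ∀ y, |F y| ≤ D * (1 + |y|) * volterraWeight K a y) :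
    ∃ B, ∀ x ≤ 0, |∫ y in Iic x, (x - y) * (W y * F y)| ≤ B * Real.exp (a * x) := by
  have hD : 0 ≤ D := by
    have h0 := (abs_nonneg _).trans (hFb 0)
    simp only [abs_zero, add_zero, mul_one] at h0
    exact nonneg_of_mul_nonneg_left h0 (volterraWeight_pos _ _ _)
  refine ⟨D * K * volterraWeight K a 0 / a, fun x hx => ?_⟩
  have h1 : ‖∫ y in Iic x, (x - y) * (W y * F y)‖ ≤
      ∫ y in Iic x, D * K * volterraWeight K a 0 * Real.exp (a * y) := by
    refine norm_integral_le_of_norm_le ((integrableOn_exp_mul_Iic ha x).const_mul _)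
      ((ae_restrict_iff' measurableSet_Iic).2 (Eventually.of_forall fun y hy => ?_))
    have hyx : y ≤ x := hy
    have h2 := abs_mul_exp_bound hWb (hFb y)
    have h3 : |x - y| ≤ 1 + |y| := by
      rw [abs_of_nonneg (by linarith), abs_of_nonpos (by linarith)]
      linarith
    have h4 : volterraWeight K a y ≤ volterraWeight K a 0 :=
      volterraWeight_mono hK ha (hyx.trans hx)
    rw [Real.norm_eq_abs, abs_mul]
    calc |x - y| * |W y * F y| ≤ (1 + |y|) * |W y * F y| := by gcongr
      _ = |W y * F y| * (1 + |y|) := by ring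
      _ ≤ D * (K * (Real.exp (a * y) * volterraWeight K a y)) := h2
      _ ≤ D * (K * (Real.exp (a * y) * volterraWeight K a 0)) := by gcongr
      _ = _ := by ring
  rw [integral_const_mul, integral_exp_mul_Iic ha] at h1
  refine h1.trans_eq ?_
  ring

variable (hW : Continuous W)

include hW

lemma volterra_integrableOn {F : ℝ → ℝ} (hF : Continuous F) {D : ℝ}
    (hFb : ∀ y, |F y| ≤ D * (1 + |y|) * volterraWeight K a y) (b : ℝ) :
    IntegrableOn (fun y => W y * F y) (Iic b) ∧
      IntegrableOn (fun y => y * (W y * F y)) (Iic b) := by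
  have hD : 0 ≤ D := by
    have h0 := (abs_nonneg _).trans (hFb 0)
    simp only [abs_zero, add_zero, mul_one] at h0
    exact nonneg_of_mul_nonneg_left h0 (volterraWeight_pos _ _ _)
  have key : ∀ b : ℝ, ∀ y ≤ b, |W y * F y| * (1 + |y|) ≤
      D * K * volterraWeight K a b * Real.exp (a * y) := by
    intro b y hy
    refine (abs_mul_exp_bound hWb (hFb y)).trans ?_
    have := volterraWeight_mono hK ha hy
    calc D * (K * (Real.exp (a * y) * volterraWeight K a y))
        ≤ D * (K * (Real.exp (a * y) * volterraWeight K a b)) := by gcongr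
      _ = _ := by ring
  constructor
  · refine integrableOn_Iic_of_exp_bound (by fun_prop) ha (fun b => ⟨D * K * volterraWeight K a b, fun y hy => ?_⟩) b
    refine le_trans ?_ (key b y hy)
    nlinarith [abs_nonneg y, abs_nonneg (W y * F y)]
  · refine integrableOn_Iic_of_exp_bound (by fun_prop) ha (fun b => ⟨D * K * volterraWeight K a b, fun y hy => ?_⟩) b
    refine le_trans ?_ (key b y hy)
    rw [abs_mul]
    nlinarith [abs_nonneg y, abs_nonneg (W y * F y)]

/-- Existence for the Volterra equation `v x = g x + ∫ y ≤ x, (x - y) * W y * v y`. -/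
theorem exists_volterra_solution {g : ℝ → ℝ} (hg : Continuous g) (hgb : ∀ x, |g x| ≤ 1 + |x|) :
    ∃ v : ℝ → ℝ, ∃ D : ℝ, Continuous v ∧
      (∀ y, |v y| ≤ D * (1 + |y|) * volterraWeight K a y) ∧
      ∀ x, v x = g x + ∫ y in Iic x, (x - y) * (W y * v y) := by
  set p : ℝ → ℝ := fun x => (1 + |x|) * volterraWeight K a x
  have hpc : Continuous p := by
    have := continuous_volterraWeight K a
    fun_prop
  have hp0 : ∀ x, 0 < p x := fun x => mul_pos (by positivity) (volterraWeight_pos _ _ _)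
  have hb : ∀ (f : ℝ →ᵇ ℝ) (y : ℝ), |p y * f y| ≤ ‖f‖ * (1 + |y|) * volterraWeight K a y := by
    intro f y
    rw [abs_mul, abs_of_pos (hp0 y), mul_assoc ‖f‖, mul_comm (p y)]
    exact mul_le_mul_of_nonneg_right (f.norm_coe_le_norm y) (hp0 y).le
  have hpf : ∀ f : ℝ →ᵇ ℝ, Continuous fun y => p y * f y := fun f => hpc.mul f.continuous
  have hint := fun f : ℝ →ᵇ ℝ => volterra_integrableOn hK ha hWb hW (hpf f) (hb f)
  set J : (ℝ →ᵇ ℝ) → ℝ → ℝ := fun f x => ∫ y in Iic x, (x - y) * (W y * (p y * f y)) with hJ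
  have hJc : ∀ f, Continuous (J f) := fun f => continuous_iff_continuousAt.2 fun x =>
    (hasDerivAt_integral_Iic_sub_mul (hW.mul (hpf f)) (fun b => (hint f b).1)
      (fun b => (hint f b).2) x).continuousAt
  have hJb : ∀ f x, |J f x| ≤ ‖f‖ / 2 * p x := fun f x =>
    volterra_abs_integral_le hK ha hWb (hb f) x
  let T : (ℝ →ᵇ ℝ) → (ℝ →ᵇ ℝ) := fun f =>
    BoundedContinuousFunction.ofNormedAddCommGroup (fun x => (g x + J f x) / p x)
      ((hg.add (hJc f)).div hpc fun x => (hp0 x).ne') (1 + ‖f‖ / 2) (by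
        intro x
        rw [Real.norm_eq_abs, abs_div, abs_of_pos (hp0 x), div_le_iff₀ (hp0 x)]
        have h1 : 1 + |x| ≤ p x :=
          le_mul_of_one_le_right (by positivity) (one_le_volterraWeight hK ha x)
        linarith [abs_add_le (g x) (J f x), hgb x, hJb f x])
  have hT : ∀ f x, T f x = (g x + J f x) / p x := fun f x => rfl
  have hJsub : ∀ f₁ f₂ x, J f₁ x - J f₂ x = J (f₁ - f₂) x := by
    intro f₁ f₂ x
    simp only [hJ]
    rw [← integral_sub
      (integrableOn_Iic_sub_mul (fun b => (hint f₁ b).1) (fun b => (hint f₁ b).2) x)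
      (integrableOn_Iic_sub_mul (fun b => (hint f₂ b).1) (fun b => (hint f₂ b).2) x)]
    congr 1
    funext y
    simp only [BoundedContinuousFunction.coe_sub, Pi.sub_apply]
    ring
  have hcontr : ContractingWith (1 / 2) T := by
    refine ⟨by norm_num, LipschitzWith.of_dist_le_mul fun f₁ f₂ => ?_⟩
    refine BoundedContinuousFunction.dist_le_iff_of_nonempty.2 fun x => ?_
    rw [hT, hT, Real.dist_eq, ← sub_div, add_sub_add_left_eq_sub, hJsub, abs_div,
      abs_of_pos (hp0 x), div_le_iff₀ (hp0 x), dist_eq_norm]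
    refine (hJb _ x).trans_eq ?_
    push_cast
    ring
  set f := ContractingWith.fixedPoint T hcontr
  have hf : T f = f := hcontr.fixedPoint_isFixedPt
  refine ⟨fun y => p y * f y, ‖f‖, hpf f, hb f, fun x => ?_⟩
  have h1 : f x = (g x + J f x) / p x := by rw [← hT, hf]
  change p x * f x = g x + J f x
  rw [h1, mul_div_cancel₀ _ (hp0 x).ne']

/-- Solutions of the Volterra equation with affine inhomogeneity `g` have second derivative `W * v`. -/
theorem exists_zero_energy_solution {g : ℝ → ℝ} {c : ℝ} (hg : ∀ x, HasDerivAt g c x)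
    (hgb : ∀ x, |g x| ≤ 1 + |x|) :
    ∃ v v' : ℝ → ℝ, (∀ x, HasDerivAt v (v' x) x) ∧ (∀ x, HasDerivAt v' (W x * v x) x) ∧
      (∀ x, v x = g x + ∫ y in Iic x, (x - y) * (W y * v y)) ∧
      ∃ B, ∀ x ≤ 0, |v x - g x| ≤ B * Real.exp (a * x) := by
  obtain ⟨v, D, hvc, hvb, hv⟩ := exists_volterra_solution hK ha hWb hW
    (continuous_iff_continuousAt.2 fun x => (hg x).continuousAt) hgb
  have hint := volterra_integrableOn hK ha hWb hW hvc hvb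
  refine ⟨v, fun x => c + ∫ y in Iic x, W y * v y, fun x => ?_, fun x => ?_, hv, ?_⟩
  · have h := (hg x).add (hasDerivAt_integral_Iic_sub_mul (hW.mul hvc) (fun b => (hint b).1)
      (fun b => (hint b).2) x)
    exact h.congr_of_eventuallyEq (Eventually.of_forall hv)
  · exact (hasDerivAt_integral_Iic (hW.mul hvc) (fun b => (hint b).1) x).const_add c
  · obtain ⟨B, hB⟩ := volterra_abs_integral_le_exp hK ha hWb hvb
    refine ⟨B, fun x hx => ?_⟩
    rw [hv x, add_sub_cancel_left]
    exact hB x hx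

end Volterra

/-- A continuous potential on `(-∞, -1]` with exponential decay extends continuously to `ℝ`,
keeping a decay that absorbs a quadratic factor. -/
lemma exists_decaying_extension {V : ℝ → ℝ} (hVc : ContinuousOn V (Iic (-1 : ℝ))) {C a : ℝ}
    (hC : 0 ≤ C) (ha : 0 < a) (hV : ∀ x ∈ Iic (-1 : ℝ), |V x| ≤ C * Real.exp (2 * a * x)) :
    ∃ W : ℝ → ℝ, ∃ K : ℝ, Continuous W ∧ 0 ≤ K ∧ (∀ x ∈ Iic (-1 : ℝ), W x = V x) ∧
      ∀ y, |W y| * (1 + |y|) ^ 2 ≤ K * Real.exp (a * y) := by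
  refine ⟨fun y => V (min y (-1)) * max 0 (min 1 (-y)), C * (1 + 2 / a) ^ 2, ?_, by positivity,
    fun x hx => ?_, fun y => ?_⟩
  · refine Continuous.mul ?_ (by fun_prop)
    exact hVc.comp_continuous (by fun_prop) fun y => mem_Iic.2 (min_le_right _ _)
  · have hx : x ≤ -1 := hx
    simp only [min_eq_left hx, min_eq_left (show 1 ≤ -x by linarith),
      max_eq_right (zero_le_one' ℝ), mul_one]
  · rcases le_total 0 y with hy | hy
    · have h0 : max 0 (min 1 (-y)) = 0 :=
        max_eq_left ((min_le_right _ _).trans (by linarith))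
      simp only [h0, mul_zero, abs_zero, zero_mul]
      positivity
    · have h1 : |V (min y (-1))| ≤ C * Real.exp (2 * a * y) := by
        refine (hV _ (mem_Iic.2 (min_le_right _ _))).trans ?_
        gcongr
        exact min_le_left _ _
      have h2 : |max 0 (min 1 (-y))| ≤ 1 := by
        rw [abs_of_nonneg (le_max_left _ _)]
        exact max_le zero_le_one (min_le_left _ _)
      have h3 : 1 + |y| ≤ (1 + 2 / a) * Real.exp (-(a * y) / 2) := by
        have h4 : -(a * y) / 2 ≤ Real.exp (-(a * y) / 2) := by
          linarith [Real.add_one_le_exp (-(a * y) / 2)]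
        have h5 : 1 ≤ Real.exp (-(a * y) / 2) := Real.one_le_exp (by nlinarith)
        have h6 : |y| = 2 / a * (-(a * y) / 2) := by
          rw [abs_of_nonpos hy]
          field_simp
        rw [h6, add_mul, one_mul]
        gcongr
      calc |V (min y (-1)) * max 0 (min 1 (-y))| * (1 + |y|) ^ 2
          ≤ C * Real.exp (2 * a * y) * 1 *
              ((1 + 2 / a) * Real.exp (-(a * y) / 2)) ^ 2 := by
            rw [abs_mul]
            gcongr
        _ = C * (1 + 2 / a) ^ 2 *
              (Real.exp (2 * a * y) * (Real.exp (-(a * y) / 2) * Real.exp (-(a * y) / 2))) := by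
            ring
        _ = _ := by
            rw [← Real.exp_add, ← Real.exp_add]
            ring_nf

lemma derivWithin_derivWithin_Iic {v v' : ℝ → ℝ} {b w : ℝ} (h : ∀ x, HasDerivAt v (v' x) x)
    {x : ℝ} (h' : HasDerivAt v' w x) (hx : x ∈ Iic b) :
    derivWithin (derivWithin v (Iic b)) (Iic b) x = w := by
  have e : EqOn (derivWithin v (Iic b)) v' (Iic b) := fun y hy =>
    (h y).hasDerivWithinAt.derivWithin (uniqueDiffOn_Iic b y hy)
  rw [derivWithin_congr e (e hx)]
  exact h'.hasDerivWithinAt.derivWithin (uniqueDiffOn_Iic b x hx)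

/-- Zero-energy solutions near the horizon: for a potential with exponential decay
`|V(x)| ≤ C e^{x/(2M)}` on `(−∞,−1]` there are solutions `v₀, v₁` of `−v''+Vv=0`
with `v₀(x) = x(1+O(x^{−1}))`, `v₁(x) = 1+O(x^{−1})` as `x → −∞`, satisfying the
stated Volterra integral equations. -/
theorem zero_energy_solutions_horizon
    (V : ℝ → ℝ) (hVc : ContinuousOn V (Set.Iic (-1 : ℝ)))
    (C M : ℝ) (hC : 0 < C) (hM : 0 < M)
    (hV : ∀ x ∈ Set.Iic (-1 : ℝ), |V x| ≤ C * Real.exp (x / (2 * M))) :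
    ∃ v₀ v₁ : ℝ → ℝ,
      (∀ x ∈ Set.Iic (-1 : ℝ),
        derivWithin (derivWithin v₀ (Set.Iic (-1 : ℝ))) (Set.Iic (-1 : ℝ)) x = V x * v₀ x) ∧
      (∀ x ∈ Set.Iic (-1 : ℝ),
        derivWithin (derivWithin v₁ (Set.Iic (-1 : ℝ))) (Set.Iic (-1 : ℝ)) x = V x * v₁ x) ∧
      (∀ x ∈ Set.Iic (-1 : ℝ),
        v₀ x / x = 1 - ∫ y in Set.Iic x, (y ^ 2 / x - y) * V y * (v₀ y / y)) ∧
      (∀ x ∈ Set.Iic (-1 : ℝ),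
        v₁ x = 1 - ∫ y in Set.Iic x, (y - x) * V y * v₁ y) ∧
      Asymptotics.IsBigO Filter.atBot (fun x => v₀ x - x) (fun _ => (1 : ℝ)) ∧
      Asymptotics.IsBigO Filter.atBot (fun x => v₁ x - 1) (fun x => x⁻¹) := by
  have ha : 0 < 1 / (4 * M) := by positivity
  set a := 1 / (4 * M) with ha_def
  have hV' : ∀ x ∈ Iic (-1 : ℝ), |V x| ≤ C * Real.exp (2 * a * x) := by
    intro x hx
    convert hV x hx using 3
    rw [ha_def]
    field_simp
    norm_num
  obtain ⟨W, K, hW, hK, hWV, hWb⟩ := exists_decaying_extension hVc hC.le ha hV'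
  obtain ⟨v₀, v₀', hd₀, hd₀', he₀, B₀, hB₀⟩ := exists_zero_energy_solution hK ha hWb hW
    (g := fun x => x) (fun x => hasDerivAt_id x) (fun x => by linarith)
  obtain ⟨v₁, v₁', hd₁, hd₁', he₁, B₁, hB₁⟩ := exists_zero_energy_solution hK ha hWb hW
    (g := fun _ => 1) (fun x => hasDerivAt_const x 1) (fun x => by simp)
  refine ⟨v₀, v₁, fun x hx => ?_, fun x hx => ?_, fun x hx => ?_, fun x hx => ?_, ?_, ?_⟩
  · rw [derivWithin_derivWithin_Iic hd₀ (hd₀' x) hx, hWV x hx]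
  · rw [derivWithin_derivWithin_Iic hd₁ (hd₁' x) hx, hWV x hx]
  · have hx1 : x ≤ -1 := hx
    have hx0 : x ≠ 0 := by linarith
    have e : ∫ y in Iic x, (y ^ 2 / x - y) * V y * (v₀ y / y) =
        ∫ y in Iic x, -x⁻¹ * ((x - y) * (W y * v₀ y)) := by
      refine setIntegral_congr_fun measurableSet_Iic fun y hy => ?_
      have hy1 : y ≤ -1 := le_trans hy hx1
      have hy0 : y ≠ 0 := by linarith
      simp only [hWV y hy1]
      field_simp
      ring
    rw [e, integral_const_mul, he₀ x]
    field_simp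
    ring
  · have hx1 : x ≤ -1 := hx
    have e : ∫ y in Iic x, (y - x) * V y * v₁ y =
        ∫ y in Iic x, -((x - y) * (W y * v₁ y)) := by
      refine setIntegral_congr_fun measurableSet_Iic fun y hy => ?_
      have hy1 : y ≤ -1 := le_trans hy hx1
      simp only [hWV y hy1]
      ring
    rw [e, integral_neg, sub_neg_eq_add]
    exact he₁ x
  · refine Asymptotics.IsBigO.of_bound |B₀| ?_
    filter_upwards [eventually_le_atBot (-1 : ℝ)] with x hx
    have h1 := hB₀ x (by linarith)
    have h2 : Real.exp (a * x) ≤ 1 := Real.exp_le_one_iff.2 (by nlinarith)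
    rw [norm_one, mul_one, Real.norm_eq_abs]
    nlinarith [le_abs_self B₀, abs_nonneg B₀, Real.exp_pos (a * x)]
  · refine Asymptotics.IsBigO.of_bound (|B₁| / a) ?_
    filter_upwards [eventually_le_atBot (-1 : ℝ)] with x hx
    have h1 := hB₁ x (by linarith)
    have hx0 : 0 < -x := by linarith
    have h2 : Real.exp (a * x) ≤ 1 / a * (-x)⁻¹ := by
      have h3 : a * -x ≤ Real.exp (-(a * x)) := by linarith [Real.add_one_le_exp (-(a * x))]
      have h4 := inv_anti₀ (by positivity) h3
      rwa [← Real.exp_neg, neg_neg, mul_inv, ← one_div a] at h4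
    rw [Real.norm_eq_abs, Real.norm_eq_abs, abs_inv, abs_of_neg (by linarith : x < 0)]
    calc |v₁ x - 1| ≤ B₁ * Real.exp (a * x) := h1
      _ ≤ |B₁| * (1 / a * (-x)⁻¹) := by
        gcongr
        exact le_abs_self _
      _ = _ := by ring
end

section
/- Let V ∈ L¹(ℝ) be real-valued and continuous with ∫_ℝ ⟨y⟩ |V(y)| dy < ∞, and fix λ₀ > 0. For λ ≥ λ₀ write the Jost solution as f₊(x,λ) = e^{iλx} m₊(x,λ). Suppose additionally V is smooth with |V^{(k)}(y)| ≤ C_k ⟨y⟩^{−2−k} for y ≥ 0. Then for all k, m ∈ ℕ₀ there are constants C_{k,m} with |∂_x^k ∂_λ^m (m₊(x,λ) − 1)| ≤ C_{k,m} ⟨x⟩^{−1−k} λ^{−1−m} for all λ ≥ λ₀ and all x ≥ 0. -/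
open Set MeasureTheory Complex

section Volterra

open Filter Topology BoundedContinuousFunction

/-- `SymbolClass l₀ n a b G`: on `x > -1`, `l > l₀`, the function `G` and its partial derivatives of
total order at most `n` obey the symbol bounds
`‖∂ₓ^k ∂ₗ^m G x l‖ ≤ C (2 + x) ^ (-a - k) l ^ (-b - m)`. -/
def SymbolClass {E : Type*} [NormedAddCommGroup E] [NormedSpace ℝ E] (l₀ : ℝ) :
    ℕ → ℕ → ℕ → (ℝ → ℝ → E) → Prop
  | 0, a, b, G => ∃ C : ℝ, ∀ x > -1, ∀ l > l₀, ‖G x l‖ ≤ C * (2 + x)⁻¹ ^ a * l⁻¹ ^ b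
  | n + 1, a, b, G =>
    (∃ C : ℝ, ∀ x > -1, ∀ l > l₀, ‖G x l‖ ≤ C * (2 + x)⁻¹ ^ a * l⁻¹ ^ b) ∧
    ∃ Gx Gl : ℝ → ℝ → E,
      (∀ x > -1, ∀ l > l₀, HasDerivAt (fun t => G t l) (Gx x l) x ∧
        HasDerivAt (fun t => G x t) (Gl x l) l) ∧
      SymbolClass l₀ n (a + 1) b Gx ∧ SymbolClass l₀ n a (b + 1) Gl

namespace SymbolClass

section Module

variable {E F : Type*} [NormedAddCommGroup E] [NormedSpace ℝ E]
  [NormedAddCommGroup F] [NormedSpace ℝ F] {l₀ : ℝ}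

theorem bound {n a b : ℕ} {G : ℝ → ℝ → E} (h : SymbolClass l₀ n a b G) :
    ∃ C : ℝ, ∀ x > -1, ∀ l > l₀, ‖G x l‖ ≤ C * (2 + x)⁻¹ ^ a * l⁻¹ ^ b := by
  cases n with
  | zero => exact h
  | succ n => exact h.1

theorem of_succ {n : ℕ} : ∀ {a b : ℕ} {G : ℝ → ℝ → E}, SymbolClass l₀ (n + 1) a b G →
    SymbolClass l₀ n a b G := by
  induction n with
  | zero => intro a b G h; exact h.1
  | succ n ih =>
    rintro a b G ⟨hb, Gx, Gl, hd, hx, hl⟩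
    exact ⟨hb, Gx, Gl, hd, ih hx, ih hl⟩

theorem exists_nonneg_bound (hl₀ : 0 < l₀) {n a b : ℕ} {G : ℝ → ℝ → E}
    (h : SymbolClass l₀ n a b G) :
    ∃ C : ℝ, 0 ≤ C ∧ ∀ x > -1, ∀ l > l₀, ‖G x l‖ ≤ C * (2 + x)⁻¹ ^ a * l⁻¹ ^ b := by
  obtain ⟨C, hC⟩ := h.bound
  refine ⟨|C|, abs_nonneg C, fun x hx l hl => (hC x hx l hl).trans ?_⟩
  have h1 : 0 < 2 + x := by linarith
  have h2 : 0 < l := hl₀.trans hl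
  gcongr
  exact le_abs_self C

theorem add {n : ℕ} : ∀ {a b : ℕ} {G H : ℝ → ℝ → E}, SymbolClass l₀ n a b G →
    SymbolClass l₀ n a b H → SymbolClass l₀ n a b (fun x l => G x l + H x l) := by
  have key : ∀ {n a b : ℕ} {G H : ℝ → ℝ → E}, SymbolClass l₀ n a b G → SymbolClass l₀ n a b H →
      ∃ C : ℝ, ∀ x > -1, ∀ l > l₀, ‖G x l + H x l‖ ≤ C * (2 + x)⁻¹ ^ a * l⁻¹ ^ b := by
    intro n a b G H hG hH
    obtain ⟨C, hC⟩ := hG.bound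
    obtain ⟨D, hD⟩ := hH.bound
    refine ⟨C + D, fun x hx l hl => (norm_add_le _ _).trans ?_⟩
    linarith [hC x hx l hl, hD x hx l hl]
  induction n with
  | zero => intro a b G H hG hH; exact key hG hH
  | succ n ih =>
    intro a b G H hG hH
    refine ⟨key hG hH, ?_⟩
    obtain ⟨-, Gx, Gl, hGd, hGx, hGl⟩ := hG
    obtain ⟨-, Hx, Hl, hHd, hHx, hHl⟩ := hH
    exact ⟨_, _, fun x hx l hl => ⟨(hGd x hx l hl).1.add (hHd x hx l hl).1,
      (hGd x hx l hl).2.add (hHd x hx l hl).2⟩, ih hGx hHx, ih hGl hHl⟩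

theorem clm_comp (L : E →L[ℝ] F) {n : ℕ} : ∀ {a b : ℕ} {G : ℝ → ℝ → E}, SymbolClass l₀ n a b G →
    SymbolClass l₀ n a b (fun x l => L (G x l)) := by
  have key : ∀ {n a b : ℕ} {G : ℝ → ℝ → E}, SymbolClass l₀ n a b G →
      ∃ C : ℝ, ∀ x > -1, ∀ l > l₀, ‖L (G x l)‖ ≤ C * (2 + x)⁻¹ ^ a * l⁻¹ ^ b := by
    intro n a b G hG
    obtain ⟨C, hC⟩ := hG.bound
    refine ⟨‖L‖ * C, fun x hx l hl => (L.le_opNorm _).trans ?_⟩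
    rw [mul_assoc, mul_assoc, ← mul_assoc C]
    gcongr
    exact hC x hx l hl
  induction n with
  | zero => intro a b G hG; exact key hG
  | succ n ih =>
    intro a b G hG
    refine ⟨key hG, ?_⟩
    obtain ⟨-, Gx, Gl, hGd, hGx, hGl⟩ := hG
    exact ⟨_, _, fun x hx l hl => ⟨L.hasFDerivAt.comp_hasDerivAt x (hGd x hx l hl).1,
      L.hasFDerivAt.comp_hasDerivAt l (hGd x hx l hl).2⟩, ih hGx, ih hGl⟩

theorem const_smul (c : ℝ) {n a b : ℕ} {G : ℝ → ℝ → E} (hG : SymbolClass l₀ n a b G) :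
    SymbolClass l₀ n a b (fun x l => c • G x l) :=
  clm_comp (c • ContinuousLinearMap.id ℝ E) hG

theorem weaken (hl₀ : 0 < l₀) (a' b' : ℕ) {n : ℕ} : ∀ {a b : ℕ} {G : ℝ → ℝ → E},
    SymbolClass l₀ n (a + a') (b + b') G → SymbolClass l₀ n a b G := by
  have key : ∀ {n a b : ℕ} {G : ℝ → ℝ → E}, SymbolClass l₀ n (a + a') (b + b') G →
      ∃ C : ℝ, ∀ x > -1, ∀ l > l₀, ‖G x l‖ ≤ C * (2 + x)⁻¹ ^ a * l⁻¹ ^ b := by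
    intro n a b G hG
    obtain ⟨C, hC0, hC⟩ := hG.exists_nonneg_bound hl₀
    refine ⟨C * l₀⁻¹ ^ b', fun x hx l hl => (hC x hx l hl).trans ?_⟩
    have h1 : 0 < 2 + x := by linarith
    have h2 : 0 < l := hl₀.trans hl
    have h3 : (2 + x)⁻¹ ^ a' ≤ 1 :=
      pow_le_one₀ (by positivity) (inv_le_one_of_one_le₀ (by linarith))
    have h4 : l⁻¹ ^ b' ≤ l₀⁻¹ ^ b' := by gcongr
    calc C * (2 + x)⁻¹ ^ (a + a') * l⁻¹ ^ (b + b')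
        = (C * (2 + x)⁻¹ ^ a * l⁻¹ ^ b) * ((2 + x)⁻¹ ^ a' * l⁻¹ ^ b') := by ring
      _ ≤ (C * (2 + x)⁻¹ ^ a * l⁻¹ ^ b) * (1 * l₀⁻¹ ^ b') := by gcongr
      _ = _ := by ring
  induction n with
  | zero => intro a b G hG; exact key hG
  | succ n ih =>
    intro a b G hG
    refine ⟨key hG, ?_⟩
    obtain ⟨-, Gx, Gl, hGd, hGx, hGl⟩ := hG
    refine ⟨Gx, Gl, hGd, ih ?_, ih ?_⟩
    · rwa [add_right_comm]
    · rwa [add_right_comm b]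

theorem exists_iteratedDeriv_left {n : ℕ} (k : ℕ) : ∀ {a b : ℕ} {G : ℝ → ℝ → E},
    SymbolClass l₀ (n + k) a b G → ∃ H : ℝ → ℝ → E, SymbolClass l₀ n (a + k) b H ∧
      ∀ x > -1, ∀ l > l₀, iteratedDeriv k (fun t => G t l) x = H x l := by
  induction k with
  | zero => intro a b G hG; exact ⟨G, hG, fun x _ l _ => by simp⟩
  | succ k ih =>
    rintro a b G ⟨-, Gx, Gl, hGd, hGx, hGl⟩
    obtain ⟨H, hH, hH'⟩ := ih hGx
    refine ⟨H, by rwa [add_assoc, add_comm 1] at hH, fun x hx l hl => ?_⟩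
    rw [← hH' x hx l hl, iteratedDeriv_succ']
    refine Filter.EventuallyEq.iteratedDeriv_eq k ?_
    filter_upwards [lt_mem_nhds hx] with t ht
    exact (hGd t ht l hl).1.deriv

theorem exists_iteratedDeriv_right {n : ℕ} (m : ℕ) : ∀ {a b : ℕ} {G : ℝ → ℝ → E},
    SymbolClass l₀ (n + m) a b G → ∃ H : ℝ → ℝ → E, SymbolClass l₀ n a (b + m) H ∧
      ∀ x > -1, ∀ l > l₀, iteratedDeriv m (fun t => G x t) l = H x l := by
  induction m with
  | zero => intro a b G hG; exact ⟨G, hG, fun x _ l _ => by simp⟩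
  | succ k ih =>
    rintro a b G ⟨-, Gx, Gl, hGd, hGx, hGl⟩
    obtain ⟨H, hH, hH'⟩ := ih hGl
    refine ⟨H, by rwa [add_assoc, add_comm 1] at hH, fun x hx l hl => ?_⟩
    rw [← hH' x hx l hl, iteratedDeriv_succ']
    refine Filter.EventuallyEq.iteratedDeriv_eq k ?_
    filter_upwards [lt_mem_nhds hl] with t ht
    exact (hGd x hx t ht).2.deriv

end Module

section Algebra

variable {A : Type*} [NormedRing A] [NormedAlgebra ℝ A] {l₀ : ℝ}

theorem mul (hl₀ : 0 < l₀) {n : ℕ} : ∀ {a b a' b' : ℕ} {G H : ℝ → ℝ → A},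
    SymbolClass l₀ n a b G → SymbolClass l₀ n a' b' H →
    SymbolClass l₀ n (a + a') (b + b') (fun x l => G x l * H x l) := by
  have key : ∀ {n a b a' b' : ℕ} {G H : ℝ → ℝ → A}, SymbolClass l₀ n a b G →
      SymbolClass l₀ n a' b' H → ∃ C : ℝ, ∀ x > -1, ∀ l > l₀,
        ‖G x l * H x l‖ ≤ C * (2 + x)⁻¹ ^ (a + a') * l⁻¹ ^ (b + b') := by
    intro n a b a' b' G H hG hH
    obtain ⟨C, hC0, hC⟩ := hG.exists_nonneg_bound hl₀
    obtain ⟨D, hD0, hD⟩ := hH.exists_nonneg_bound hl₀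
    refine ⟨C * D, fun x hx l hl => (norm_mul_le _ _).trans ?_⟩
    have h1 : 0 < 2 + x := by linarith
    have h2 : 0 < l := hl₀.trans hl
    calc ‖G x l‖ * ‖H x l‖
        ≤ (C * (2 + x)⁻¹ ^ a * l⁻¹ ^ b) * (D * (2 + x)⁻¹ ^ a' * l⁻¹ ^ b') := by
          gcongr
          · exact hC x hx l hl
          · exact hD x hx l hl
      _ = _ := by ring
  induction n with
  | zero => intro a b a' b' G H hG hH; exact key hG hH
  | succ n ih =>
    intro a b a' b' G H hG hH
    refine ⟨key hG hH, ?_⟩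
    have hG' := hG.of_succ
    have hH' := hH.of_succ
    obtain ⟨-, Gx, Gl, hGd, hGx, hGl⟩ := hG
    obtain ⟨-, Hx, Hl, hHd, hHx, hHl⟩ := hH
    refine ⟨_, _, fun x hx l hl => ⟨(hGd x hx l hl).1.mul (hHd x hx l hl).1,
      (hGd x hx l hl).2.mul (hHd x hx l hl).2⟩, ?_, ?_⟩
    · have h1 := ih hGx hH'
      rw [add_right_comm] at h1
      have h2 := ih hG' hHx
      rw [← add_assoc] at h2
      exact h1.add h2
    · have h1 := ih hGl hH'
      rw [add_right_comm b] at h1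
      have h2 := ih hG' hHl
      rw [← add_assoc b] at h2
      exact h1.add h2

theorem inverse_one_sub [HasSummableGeomSeries A] (hl₀ : 0 < l₀) {K : ℝ → ℝ → A}
    (hK : ∀ n, SymbolClass l₀ n 1 1 K) (hu : ∀ x > -1, ∀ l > l₀, IsUnit (1 - K x l))
    (hb : ∃ C : ℝ, ∀ x > -1, ∀ l > l₀, ‖Ring.inverse (1 - K x l)‖ ≤ C) (n : ℕ) :
    SymbolClass l₀ n 0 0 (fun x l => Ring.inverse (1 - K x l)) := by
  have hder : ∀ {f : ℝ → A} {f' : A} {t : ℝ}, IsUnit (1 - f t) → HasDerivAt f f' t →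
      HasDerivAt (fun s => Ring.inverse (1 - f s))
        (Ring.inverse (1 - f t) * f' * Ring.inverse (1 - f t)) t := by
    rintro f f' t ⟨u, hu⟩ hf
    have h1 : HasFDerivAt Ring.inverse (-ContinuousLinearMap.mulLeftRight ℝ A ↑u⁻¹ ↑u⁻¹) (1 - f t) :=
      hu ▸ hasFDerivAt_ringInverse (𝕜 := ℝ) u
    have h2 := h1.comp_hasDerivAt t (hf.const_sub 1)
    rw [← hu, Ring.inverse_unit]
    simpa using! h2
  have hb' : ∃ C : ℝ, ∀ x > -1, ∀ l > l₀,
      ‖Ring.inverse (1 - K x l)‖ ≤ C * (2 + x)⁻¹ ^ 0 * l⁻¹ ^ 0 := by simpa using hb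
  induction n with
  | zero => exact hb'
  | succ n ih =>
    refine ⟨hb', ?_⟩
    obtain ⟨-, Kx, Kl, hKd, hKx, hKl⟩ := hK (n + 1)
    exact ⟨_, _, fun x hx l hl => ⟨hder (hu x hx l hl) (hKd x hx l hl).1,
      hder (hu x hx l hl) (hKd x hx l hl).2⟩,
      weaken hl₀ 1 1 (by simpa using mul hl₀ (mul hl₀ ih hKx) ih),
      weaken hl₀ 1 1 (by simpa using mul hl₀ (mul hl₀ ih hKl) ih)⟩

end Algebra

end SymbolClass

/-- The kernel `(e^{2is} - 1) / (2i)` of the Volterra equation, cut off at `s = 0`. -/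
noncomputable def volterraKernel (s : ℝ) : ℂ :=
  (exp (2 * I * (max s 0 : ℝ)) - 1) / (2 * I)

theorem continuous_volterraKernel : Continuous volterraKernel := by
  unfold volterraKernel
  fun_prop

theorem volterraKernel_of_nonpos {s : ℝ} (hs : s ≤ 0) : volterraKernel s = 0 := by
  simp [volterraKernel, max_eq_right hs]

theorem norm_volterraKernel_le (s : ℝ) : ‖volterraKernel s‖ ≤ 1 := by
  have h1 : ‖exp (2 * I * (max s 0 : ℝ))‖ = 1 := by
    have : 2 * I * ((max s 0 : ℝ) : ℂ) = ((2 * max s 0 : ℝ) : ℂ) * I := by push_cast; ring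
    rw [this, norm_exp_ofReal_mul_I]
  have h2 := norm_sub_le (exp (2 * I * (max s 0 : ℝ))) 1
  rw [h1, norm_one] at h2
  rw [volterraKernel, norm_div, norm_mul, norm_I, Complex.norm_ofNat]
  linarith

theorem norm_volterraKernel_mul_mul_le (w : ℝ → ℂ) (f : ℝ →ᵇ ℂ) (η ζ : ℝ) :
    ‖volterraKernel (ζ - η) * w ζ * f ζ‖ ≤ ‖w ζ‖ * ‖f‖ := by
  rw [norm_mul, norm_mul]
  calc ‖volterraKernel (ζ - η)‖ * ‖w ζ‖ * ‖f ζ‖ ≤ 1 * ‖w ζ‖ * ‖f‖ := by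
        gcongr
        · exact norm_volterraKernel_le _
        · exact f.norm_coe_le_norm ζ
    _ = _ := by ring

theorem integrableOn_volterraKernel_mul_mul {w : ℝ → ℂ} (hw : IntegrableOn w (Ioi 0))
    (f : ℝ →ᵇ ℂ) (η : ℝ) :
    IntegrableOn (fun ζ => volterraKernel (ζ - η) * w ζ * f ζ) (Ioi 0) := by
  refine (hw.norm.mul_const ‖f‖).mono' ?_
    (ae_of_all _ (norm_volterraKernel_mul_mul_le w f η))
  have h1 : Continuous fun ζ => volterraKernel (ζ - η) :=
    continuous_volterraKernel.comp (by fun_prop)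
  exact (h1.aestronglyMeasurable.mul hw.aestronglyMeasurable).mul
    f.continuous.aestronglyMeasurable

theorem norm_integral_volterraKernel_le {w : ℝ → ℂ} (hw : IntegrableOn w (Ioi 0))
    (f : ℝ →ᵇ ℂ) (η : ℝ) :
    ‖∫ ζ in Ioi 0, volterraKernel (ζ - η) * w ζ * f ζ‖ ≤ (∫ ζ in Ioi 0, ‖w ζ‖) * ‖f‖ := by
  rw [← integral_mul_const]
  exact norm_integral_le_of_norm_le (hw.norm.mul_const ‖f‖)
    (ae_of_all _ (norm_volterraKernel_mul_mul_le w f η))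

theorem continuous_integral_volterraKernel {w : ℝ → ℂ} (hw : IntegrableOn w (Ioi 0))
    (f : ℝ →ᵇ ℂ) :
    Continuous fun η => ∫ ζ in Ioi 0, volterraKernel (ζ - η) * w ζ * f ζ := by
  refine continuous_of_dominated
    (fun η => (integrableOn_volterraKernel_mul_mul hw f η).aestronglyMeasurable)
    (fun η => ae_of_all _ (norm_volterraKernel_mul_mul_le w f η)) (hw.norm.mul_const ‖f‖)
    (ae_of_all _ fun ζ => ?_)
  exact ((continuous_volterraKernel.comp (by fun_prop)).mul continuous_const).mul continuous_const

open Classical in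
/-- The Volterra operator `f ↦ ∫_{ζ > 0} k(ζ - η) w(ζ) f(ζ) dζ` on bounded continuous functions,
for an integrable weight `w`. -/
noncomputable def volterraOp (w : ℝ → ℂ) : (ℝ →ᵇ ℂ) →L[ℂ] (ℝ →ᵇ ℂ) :=
  if hw : IntegrableOn w (Ioi 0) then
    LinearMap.mkContinuous
      { toFun := fun f => BoundedContinuousFunction.ofNormedAddCommGroup
          (fun η => ∫ ζ in Ioi 0, volterraKernel (ζ - η) * w ζ * f ζ)
          (continuous_integral_volterraKernel hw f) ((∫ ζ in Ioi 0, ‖w ζ‖) * ‖f‖)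
          (norm_integral_volterraKernel_le hw f)
        map_add' := fun f g => by
          ext η
          simp only [BoundedContinuousFunction.coe_ofNormedAddCommGroup,
            BoundedContinuousFunction.coe_add, Pi.add_apply, mul_add]
          exact integral_add (integrableOn_volterraKernel_mul_mul hw f η)
            (integrableOn_volterraKernel_mul_mul hw g η)
        map_smul' := fun c f => by
          ext η
          simp only [BoundedContinuousFunction.coe_ofNormedAddCommGroup,
            BoundedContinuousFunction.coe_smul, smul_eq_mul, RingHom.id_apply]
          rw [← integral_const_mul]
          exact integral_congr_ae (ae_of_all _ fun ζ => by ring) }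
      (∫ ζ in Ioi 0, ‖w ζ‖) fun f =>
        (BoundedContinuousFunction.norm_le (by positivity)).2 (norm_integral_volterraKernel_le hw f)
  else 0

theorem volterraOp_apply {w : ℝ → ℂ} (hw : IntegrableOn w (Ioi 0)) (f : ℝ →ᵇ ℂ) (η : ℝ) :
    volterraOp w f η = ∫ ζ in Ioi 0, volterraKernel (ζ - η) * w ζ * f ζ := by
  rw [volterraOp, dif_pos hw]
  rfl

theorem norm_volterraOp_le {w : ℝ → ℂ} (hw : IntegrableOn w (Ioi 0)) :
    ‖volterraOp w‖ ≤ ∫ ζ in Ioi 0, ‖w ζ‖ := by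
  refine ContinuousLinearMap.opNorm_le_bound _ (by positivity) fun f =>
    (BoundedContinuousFunction.norm_le (by positivity)).2 fun η => ?_
  rw [volterraOp_apply hw]
  exact norm_integral_volterraKernel_le hw f η

theorem volterraOp_add {v w : ℝ → ℂ} (hv : IntegrableOn v (Ioi 0)) (hw : IntegrableOn w (Ioi 0)) :
    volterraOp (fun ζ => v ζ + w ζ) = volterraOp v + volterraOp w := by
  ext f η
  rw [_root_.add_apply, BoundedContinuousFunction.add_apply,
    volterraOp_apply (w := fun ζ => v ζ + w ζ) (hv.add hw), volterraOp_apply hv, volterraOp_apply hw,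
    ← integral_add (integrableOn_volterraKernel_mul_mul hv f η)
      (integrableOn_volterraKernel_mul_mul hw f η)]
  exact integral_congr_ae (ae_of_all _ fun ζ => by ring)

theorem volterraOp_const_smul {w : ℝ → ℂ} (hw : IntegrableOn w (Ioi 0)) (c : ℝ) :
    volterraOp (fun ζ => c • w ζ) = c • volterraOp w := by
  ext f η
  rw [_root_.smul_apply, BoundedContinuousFunction.smul_apply,
    volterraOp_apply (w := fun ζ => c • w ζ) (hw.smul c), volterraOp_apply hw, ← integral_smul]
  exact integral_congr_ae (ae_of_all _ fun ζ => by simp only [real_smul]; ring)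

theorem volterraOp_sub {v w : ℝ → ℂ} (hv : IntegrableOn v (Ioi 0)) (hw : IntegrableOn w (Ioi 0)) :
    volterraOp (fun ζ => v ζ - w ζ) = volterraOp v - volterraOp w := by
  have h := volterraOp_add (hv.sub hw) hw
  simp only [Pi.sub_apply, sub_add_cancel] at h
  rw [eq_sub_iff_add_eq]
  exact h.symm

theorem hasDerivAt_volterraOp {w w' : ℝ → ℝ → ℂ} {b : ℝ → ℝ} {t : ℝ} {s : Set ℝ} (hs : s ∈ 𝓝 t)
    (hsc : Convex ℝ s) (hd : ∀ u ∈ s, ∀ ζ > 0, HasDerivAt (fun u => w u ζ) (w' u ζ) u)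
    (hw : ∀ u ∈ s, IntegrableOn (w u) (Ioi 0)) (hw' : IntegrableOn (w' t) (Ioi 0))
    (hb : IntegrableOn b (Ioi 0)) (hbd : ∀ u ∈ s, ∀ ζ > 0, ‖w' u ζ‖ ≤ b ζ) :
    HasDerivAt (fun u => volterraOp (w u)) (volterraOp (w' t)) t := by
  have ht := mem_of_mem_nhds hs
  refine (hasDerivAt_iff_tendsto (F := (ℝ →ᵇ ℂ) →L[ℂ] (ℝ →ᵇ ℂ))).2 ?_
  have hint : ∀ u ∈ s, IntegrableOn (fun ζ => w u ζ - w t ζ - (u - t) • w' t ζ) (Ioi 0) :=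
    fun u hu => ((hw u hu).sub (hw t ht)).sub (hw'.smul (u - t))
  have hlim : Tendsto
      (fun u => ∫ ζ in Ioi 0, ‖u - t‖⁻¹ * ‖w u ζ - w t ζ - (u - t) • w' t ζ‖) (𝓝 t) (𝓝 0) := by
    rw [show 𝓝 (0 : ℝ) = 𝓝 (∫ ζ in Ioi (0 : ℝ), (0 : ℝ)) by simp]
    refine tendsto_integral_filter_of_dominated_convergence (fun ζ => 2 * b ζ) ?_ ?_
      (hb.const_mul 2) ?_
    · filter_upwards [hs] with u hu
      exact ((hint u hu).norm.const_mul _).aestronglyMeasurable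
    · filter_upwards [hs] with u hu
      filter_upwards [ae_restrict_mem measurableSet_Ioi] with ζ hζ
      have h1 : ‖w u ζ - w t ζ‖ ≤ b ζ * ‖u - t‖ :=
        hsc.norm_image_sub_le_of_norm_hasDerivWithin_le
          (fun v hv => (hd v hv ζ hζ).hasDerivWithinAt) (fun v hv => hbd v hv ζ hζ) ht hu
      have h2 : ‖w u ζ - w t ζ - (u - t) • w' t ζ‖ ≤ 2 * b ζ * ‖u - t‖ := by
        refine (norm_sub_le _ _).trans ?_
        rw [norm_smul]
        nlinarith [mul_le_mul_of_nonneg_left (hbd t ht ζ hζ) (norm_nonneg (u - t))]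
      rw [norm_mul, norm_inv, norm_norm, norm_norm]
      rcases eq_or_ne u t with rfl | hne
      · have := (norm_nonneg _).trans (hbd u hu ζ hζ)
        simpa using this
      · have : 0 < ‖u - t‖ := norm_pos_iff.2 (sub_ne_zero.2 hne)
        rw [inv_mul_le_iff₀ this]
        linarith
    · filter_upwards [ae_restrict_mem measurableSet_Ioi] with ζ hζ
      exact hasDerivAt_iff_tendsto.1 (hd t ht ζ hζ)
  refine squeeze_zero' (Eventually.of_forall fun u => by positivity) ?_ hlim
  filter_upwards [hs] with u hu
  rw [integral_const_mul]
  gcongr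
  have := norm_volterraOp_le (hint u hu)
  rwa [volterraOp_sub (v := fun ζ => w u ζ - w t ζ) (w := fun ζ => (u - t) • w' t ζ)
    ((hw u hu).sub (hw t ht)) (hw'.smul (u - t)), volterraOp_sub (hw u hu) (hw t ht),
    volterraOp_const_smul hw'] at this

theorem majorant_integral {A s l : ℝ} (hA : 0 ≤ A) (hs : 0 < s) (hl : 0 < l) (n : ℕ) {a : ℝ}
    (ha : 0 ≤ a) :
    IntegrableOn (fun ζ => A / l * ((s + ζ / l) ^ 2)⁻¹ *
      ((A * (s + ζ / l)⁻¹) ^ n / n.factorial)) (Ioi a) ∧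
    ∫ ζ in Ioi a, A / l * ((s + ζ / l) ^ 2)⁻¹ * ((A * (s + ζ / l)⁻¹) ^ n / n.factorial) =
      (A * (s + a / l)⁻¹) ^ (n + 1) / (n + 1).factorial := by
  have hpos : ∀ ζ ≥ a, 0 < s + ζ / l := fun ζ hζ => by
    have : 0 ≤ ζ := ha.trans hζ
    positivity
  have hd : ∀ ζ ∈ Ici a, HasDerivAt (fun ζ => -((A * (s + ζ / l)⁻¹) ^ (n + 1) / (n + 1).factorial))
      (A / l * ((s + ζ / l) ^ 2)⁻¹ * ((A * (s + ζ / l)⁻¹) ^ n / n.factorial)) ζ := by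
    intro ζ hζ
    have hne := (hpos ζ hζ).ne'
    have h1 : HasDerivAt (fun ζ => s + ζ / l) (1 / l) ζ :=
      ((hasDerivAt_id ζ).div_const l).const_add s
    have h2 := ((((h1.inv hne).const_mul A).pow (n + 1)).div_const
      ((n + 1).factorial : ℝ)).neg
    convert! h2 using 1
    have hf : (n.factorial : ℝ) ≠ 0 := by positivity
    rw [Nat.factorial_succ]
    push_cast
    simp only [Pi.inv_apply]
    field_simp
  have hp : ∀ ζ ∈ Ioi a,
      0 ≤ A / l * ((s + ζ / l) ^ 2)⁻¹ * ((A * (s + ζ / l)⁻¹) ^ n / n.factorial) := by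
    intro ζ hζ
    have := hpos ζ (le_of_lt hζ)
    positivity
  have hlim : Tendsto (fun ζ => -((A * (s + ζ / l)⁻¹) ^ (n + 1) / (n + 1).factorial)) atTop
      (𝓝 0) := by
    have h1 : Tendsto (fun ζ : ℝ => (s + ζ / l)⁻¹) atTop (𝓝 0) :=
      tendsto_inv_atTop_zero.comp
        (tendsto_atTop_add_const_left _ s (tendsto_id.atTop_div_const hl))
    simpa using (((h1.const_mul A).pow (n + 1)).div_const ((n + 1).factorial : ℝ)).neg
  refine ⟨integrableOn_Ioi_deriv_of_nonneg' hd hp hlim, ?_⟩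
  rw [integral_Ioi_of_hasDerivAt_of_nonneg' hd hp hlim]
  ring

theorem integrableOn_majorant {A s l : ℝ} (hA : 0 ≤ A) (hs : 0 < s) (hl : 0 < l) :
    IntegrableOn (fun ζ => A / l * ((s + ζ / l) ^ 2)⁻¹) (Ioi 0) := by
  simpa using (majorant_integral hA hs hl 0 le_rfl).1

theorem norm_volterraOp_le_of_majorant {w : ℝ → ℂ} {A s l : ℝ} (hA : 0 ≤ A) (hs : 0 < s)
    (hl : 0 < l) (hw : IntegrableOn w (Ioi 0))
    (hb : ∀ ζ > 0, ‖w ζ‖ ≤ A / l * ((s + ζ / l) ^ 2)⁻¹) : ‖volterraOp w‖ ≤ A * s⁻¹ := by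
  have h := (majorant_integral hA hs hl 0 le_rfl).2
  simp only [pow_zero, Nat.factorial_zero, Nat.cast_one, div_one, mul_one, zero_div, add_zero,
    zero_add, pow_one, Nat.factorial_one] at h
  rw [← h]
  exact (norm_volterraOp_le hw).trans (setIntegral_mono_on hw.norm (integrableOn_majorant hA hs hl)
    measurableSet_Ioi hb)

theorem norm_volterraOp_pow_apply_le {w : ℝ → ℂ} {A s l : ℝ} (hA : 0 ≤ A) (hs : 0 < s)
    (hl : 0 < l) (hw : IntegrableOn w (Ioi 0))
    (hb : ∀ ζ > 0, ‖w ζ‖ ≤ A / l * ((s + ζ / l) ^ 2)⁻¹) (f : ℝ →ᵇ ℂ) (n : ℕ) (η : ℝ) :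
    ‖(volterraOp w ^ n) f η‖ ≤ (A * (s + max η 0 / l)⁻¹) ^ n / n.factorial * ‖f‖ := by
  induction n generalizing η with
  | zero => simpa using f.norm_coe_le_norm η
  | succ n ih =>
    have hm : 0 ≤ max η 0 := le_max_right _ _
    obtain ⟨hi, he⟩ := majorant_integral hA hs hl n hm
    have hsub : Ioi (max η 0) ⊆ Ioi 0 := Ioi_subset_Ioi hm
    rw [pow_succ', mul_apply_eq_comp, volterraOp_apply hw,
      setIntegral_eq_of_subset_of_forall_sdiff_eq_zero measurableSet_Ioi hsub, ← he,
      ← integral_mul_const]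
    · refine norm_integral_le_of_norm_le (hi.mul_const _) ?_
      filter_upwards [ae_restrict_mem measurableSet_Ioi] with ζ hζ
      have hζ0 : 0 < ζ := hsub hζ
      have h1 := ih ζ
      rw [max_eq_left hζ0.le] at h1
      rw [norm_mul, norm_mul, mul_assoc (A / l * _)]
      have h2 : ‖volterraKernel (ζ - η)‖ * ‖w ζ‖ ≤ 1 * (A / l * ((s + ζ / l) ^ 2)⁻¹) :=
        mul_le_mul (norm_volterraKernel_le _) (hb ζ hζ0) (norm_nonneg _) zero_le_one
      rw [one_mul] at h2
      exact mul_le_mul h2 h1 (norm_nonneg _) (by positivity)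
    · rintro ζ ⟨hζ, hζ'⟩
      have : ζ ≤ η := by
        simp only [mem_Ioi, max_lt_iff, not_and_or, not_lt] at hζ hζ'
        rcases hζ' with h | h
        · exact h
        · exact absurd hζ (not_lt.2 h)
      rw [volterraKernel_of_nonpos (by linarith), zero_mul, zero_mul]

theorem isUnit_one_sub_volterraOp {w : ℝ → ℂ} {A s l : ℝ} (hA : 0 ≤ A) (hs : 1 ≤ s)
    (hl : 0 < l) (hw : IntegrableOn w (Ioi 0))
    (hb : ∀ ζ > 0, ‖w ζ‖ ≤ A / l * ((s + ζ / l) ^ 2)⁻¹) :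
    IsUnit (1 - volterraOp w) ∧ ‖Ring.inverse (1 - volterraOp w)‖ ≤ Real.exp A := by
  have hbound : ∀ n : ℕ, ‖volterraOp w ^ n‖ ≤ A ^ n / n.factorial := by
    intro n
    refine ContinuousLinearMap.opNorm_le_bound _ (by positivity) fun f =>
      (BoundedContinuousFunction.norm_le (by positivity)).2 fun η =>
      (norm_volterraOp_pow_apply_le hA (by linarith) hl hw hb f n η).trans ?_
    have h1 : 1 ≤ s + max η 0 / l := by
      have : 0 ≤ max η 0 / l := div_nonneg (le_max_right _ _) hl.le
      linarith
    gcongr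
    exact mul_le_of_le_one_right hA (inv_le_one_of_one_le₀ h1)
  have hexp : HasSum (fun n : ℕ => A ^ n / n.factorial) (Real.exp A) := by
    rw [Real.exp_eq_exp_ℝ]
    exact NormedSpace.expSeries_div_hasSum_exp A
  have hsum : Summable (volterraOp w ^ ·) := Summable.of_norm_bounded hexp.summable hbound
  let u : ((ℝ →ᵇ ℂ) →L[ℂ] (ℝ →ᵇ ℂ))ˣ :=
    ⟨1 - volterraOp w, ∑' n : ℕ, volterraOp w ^ n, hsum.one_sub_mul_tsum_pow,
      hsum.tsum_pow_mul_one_sub⟩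
  refine ⟨u.isUnit, ?_⟩
  have : Ring.inverse (1 - volterraOp w) = ∑' n : ℕ, volterraOp w ^ n := Ring.inverse_unit u
  rw [this]
  exact tsum_of_norm_bounded hexp hbound

/-- The weights `ζ^j l^(-j-q-1) V^(j+p)(x + ζ/l)`, a family closed under differentiation in the
parameters `x` and `l`. -/
noncomputable def jostWeight (V : ℝ → ℝ) (j p q : ℕ) (x l ζ : ℝ) : ℂ :=
  ((ζ ^ j * l⁻¹ ^ (j + q + 1) * iteratedDeriv (j + p) V (x + ζ / l) : ℝ) : ℂ)

section JostWeight

variable {V : ℝ → ℝ} (hV : ContDiff ℝ (⊤ : ℕ∞) V) {D : ℕ → ℝ} (hD0 : ∀ i, 0 ≤ D i)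
  (hD : ∀ i, ∀ y > -1, |iteratedDeriv i V y| ≤ D i * (2 + y)⁻¹ ^ (2 + i))

include hV in
theorem hasDerivAt_iteratedDeriv_of_contDiff (i : ℕ) (y : ℝ) :
    HasDerivAt (iteratedDeriv i V) (iteratedDeriv (i + 1) V y) y := by
  rw [iteratedDeriv_succ]
  exact (hV.differentiable_iteratedDeriv i (by exact_mod_cast ENat.natCast_lt_top i) y).hasDerivAt

include hV in
theorem continuous_jostWeight (j p q : ℕ) (x l : ℝ) : Continuous (jostWeight V j p q x l) := by
  have h : Continuous (iteratedDeriv (j + p) V) :=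
    hV.continuous_iteratedDeriv _ (by exact_mod_cast le_top)
  unfold jostWeight
  fun_prop

include hD0 hD in
theorem norm_jostWeight_le (j p q : ℕ) {x l ζ : ℝ} (hx : x > -1) (hl : 0 < l) (hζ : 0 < ζ) :
    ‖jostWeight V j p q x l ζ‖ ≤
      D (j + p) * l⁻¹ ^ q * (2 + x)⁻¹ ^ p / l * ((2 + x + ζ / l) ^ 2)⁻¹ := by
  have hz : 0 < ζ / l := by positivity
  have h2x : 0 < 2 + x := by linarith
  have hy : 0 < 2 + x + ζ / l := by linarith
  have hDV := hD (j + p) (x + ζ / l) (by linarith)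
  rw [← add_assoc 2 x] at hDV
  have h1 : (ζ / l) ^ j ≤ (2 + x + ζ / l) ^ j :=
    pow_le_pow_left₀ hz.le (by linarith) j
  have h2 : (2 + x + ζ / l)⁻¹ ^ p ≤ (2 + x)⁻¹ ^ p :=
    pow_le_pow_left₀ (inv_nonneg.2 hy.le) (inv_anti₀ h2x (by linarith)) p
  have hDj := hD0 (j + p)
  rw [jostWeight, norm_real, Real.norm_eq_abs, abs_mul, abs_mul, abs_of_pos (pow_pos hζ j),
    abs_of_pos (by positivity : 0 < l⁻¹ ^ (j + q + 1))]
  calc ζ ^ j * l⁻¹ ^ (j + q + 1) * |iteratedDeriv (j + p) V (x + ζ / l)|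
      = (ζ / l) ^ j * l⁻¹ ^ (q + 1) * |iteratedDeriv (j + p) V (x + ζ / l)| := by
        rw [div_eq_mul_inv]; ring
    _ ≤ (2 + x + ζ / l) ^ j * l⁻¹ ^ (q + 1) *
          (D (j + p) * (2 + x + ζ / l)⁻¹ ^ (2 + (j + p))) := by gcongr
    _ = D (j + p) * l⁻¹ ^ q * (2 + x + ζ / l)⁻¹ ^ p / l * ((2 + x + ζ / l) ^ 2)⁻¹ := by
        have : (2 + x + ζ / l) ^ j * (2 + x + ζ / l)⁻¹ ^ j = 1 := by
          rw [← mul_pow, mul_inv_cancel₀ hy.ne', one_pow]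
        rw [div_eq_mul_inv, ← inv_pow]
        linear_combination (l⁻¹ ^ (q + 1) * D (j + p) * (2 + x + ζ / l)⁻¹ ^ (p + 2)) * this
    _ ≤ _ := by gcongr

include hD0 hD in
theorem norm_jostWeight_le_uniform (j p q : ℕ) {l₀ L x l ζ : ℝ} (hl₀ : 0 < l₀) (hx : x > -1)
    (hl : l₀ < l) (hL : l < L) (hζ : 0 < ζ) :
    ‖jostWeight V j p q x l ζ‖ ≤
      L * (D (j + p) * l₀⁻¹ ^ (q + 1)) / L * ((1 + ζ / L) ^ 2)⁻¹ := by
  have hl' : 0 < l := hl₀.trans hl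
  have hL' : 0 < L := hl'.trans hL
  have hDj := hD0 (j + p)
  refine (norm_jostWeight_le hD0 hD j p q hx hl' hζ).trans ?_
  have h0 : 0 < 2 + x := by linarith
  have h1 : (2 + x)⁻¹ ^ p ≤ 1 :=
    pow_le_one₀ (inv_nonneg.2 (by linarith)) (inv_le_one_of_one_le₀ (by linarith))
  have h2 : 1 + ζ / L ≤ 2 + x + ζ / l := by
    have : ζ / L ≤ ζ / l := by gcongr
    linarith
  have h3 : l⁻¹ ^ (q + 1) ≤ l₀⁻¹ ^ (q + 1) := by gcongr
  rw [mul_div_cancel_left₀ _ hL'.ne']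
  calc D (j + p) * l⁻¹ ^ q * (2 + x)⁻¹ ^ p / l * ((2 + x + ζ / l) ^ 2)⁻¹
      = D (j + p) * l⁻¹ ^ (q + 1) * (2 + x)⁻¹ ^ p * ((2 + x + ζ / l) ^ 2)⁻¹ := by
        rw [div_eq_mul_inv]; ring
    _ ≤ D (j + p) * l₀⁻¹ ^ (q + 1) * 1 * ((1 + ζ / L) ^ 2)⁻¹ := by gcongr
    _ = _ := by ring

include hV hD0 hD in
theorem integrableOn_jostWeight (j p q : ℕ) {x l : ℝ} (hx : x > -1) (hl : 0 < l) :
    IntegrableOn (jostWeight V j p q x l) (Ioi 0) := by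
  have h2x : 0 < 2 + x := by linarith
  have hDj := hD0 (j + p)
  refine (integrableOn_majorant (A := D (j + p) * l⁻¹ ^ q * (2 + x)⁻¹ ^ p) (by positivity) h2x
    hl).mono' (continuous_jostWeight hV j p q x l).aestronglyMeasurable ?_
  filter_upwards [ae_restrict_mem measurableSet_Ioi] with ζ hζ
  exact norm_jostWeight_le hD0 hD j p q hx hl hζ

include hV in
theorem hasDerivAt_jostWeight_left (j p q : ℕ) (x l ζ : ℝ) :
    HasDerivAt (fun x => jostWeight V j p q x l ζ) (jostWeight V j (p + 1) q x l ζ) x := by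
  have h1 : HasDerivAt (fun x => iteratedDeriv (j + p) V (x + ζ / l))
      (iteratedDeriv (j + p + 1) V (x + ζ / l)) x :=
    (hasDerivAt_iteratedDeriv_of_contDiff hV _ _).comp_add_const x (ζ / l)
  exact (h1.const_mul (ζ ^ j * l⁻¹ ^ (j + q + 1))).ofReal_comp

include hV in
theorem hasDerivAt_jostWeight_right (j p q : ℕ) (x ζ : ℝ) {l : ℝ} (hl : l ≠ 0) :
    HasDerivAt (fun l => jostWeight V j p q x l ζ)
      ((-(j + q + 1) : ℝ) • jostWeight V j p (q + 1) x l ζ +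
        (-1 : ℝ) • jostWeight V (j + 1) p (q + 1) x l ζ) l := by
  have h0 : HasDerivAt (fun l : ℝ => l⁻¹) (-(l ^ 2)⁻¹) l := hasDerivAt_inv hl
  have h1 : HasDerivAt (fun l => iteratedDeriv (j + p) V (x + ζ * l⁻¹))
      (iteratedDeriv (j + p + 1) V (x + ζ * l⁻¹) * (ζ * -(l ^ 2)⁻¹)) l :=
    (hasDerivAt_iteratedDeriv_of_contDiff hV _ _).comp l ((h0.const_mul ζ).const_add x)
  have h2 := (((h0.pow (j + q + 1)).const_mul (ζ ^ j)).mul h1).ofReal_comp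
  simp only [jostWeight, real_smul, div_eq_mul_inv]
  convert! h2 using 1
  rw [show j + 1 + p = j + p + 1 by ring, ← ofReal_mul, ← ofReal_mul, ← ofReal_add]
  congr 1
  simp only [Pi.pow_apply, add_tsub_cancel_right]
  push_cast
  rw [← inv_pow]
  ring

include hV hD0 hD in
theorem hasDerivAt_volterraOp_jostWeight_left (j p q : ℕ) {x l : ℝ} (hx : x > -1) (hl : 0 < l) :
    HasDerivAt (fun x => volterraOp (jostWeight V j p q x l))
      (volterraOp (jostWeight V j (p + 1) q x l)) x := by
  have hDj := hD0 (j + (p + 1))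
  refine hasDerivAt_volterraOp (w' := fun x => jostWeight V j (p + 1) q x l) (Ioi_mem_nhds hx)
    (convex_Ioi _) (fun u _ ζ _ => hasDerivAt_jostWeight_left hV j p q u l ζ)
    (fun u hu => integrableOn_jostWeight hV hD0 hD j p q hu hl)
    (integrableOn_jostWeight hV hD0 hD j (p + 1) q hx hl)
    (integrableOn_majorant (A := (l + 1) * (D (j + (p + 1)) * (l / 2)⁻¹ ^ (q + 1)))
      (l := l + 1) (by positivity) one_pos (by positivity))
    (fun u hu ζ hζ => norm_jostWeight_le_uniform hD0 hD j (p + 1) q (half_pos hl) hu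
      (half_lt_self hl) (lt_add_one l) hζ)

include hV hD0 hD in
theorem hasDerivAt_volterraOp_jostWeight_right (j p q : ℕ) {x l : ℝ} (hx : x > -1) (hl : 0 < l) :
    HasDerivAt (fun l => volterraOp (jostWeight V j p q x l))
      ((-(j + q + 1) : ℝ) • volterraOp (jostWeight V j p (q + 1) x l) +
        (-1 : ℝ) • volterraOp (jostWeight V (j + 1) p (q + 1) x l)) l := by
  have hi1 := integrableOn_jostWeight hV hD0 hD j p (q + 1) hx hl
  have hi2 := integrableOn_jostWeight hV hD0 hD (j + 1) p (q + 1) hx hl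
  have hDj := hD0 (j + p)
  have hDj' := hD0 (j + 1 + p)
  rw [← volterraOp_const_smul hi1, ← volterraOp_const_smul hi2,
    ← volterraOp_add (v := fun ζ => (-(j + q + 1) : ℝ) • jostWeight V j p (q + 1) x l ζ)
      (w := fun ζ => (-1 : ℝ) • jostWeight V (j + 1) p (q + 1) x l ζ)
      (hi1.smul (-(j + q + 1) : ℝ)) (hi2.smul (-1 : ℝ))]
  have hs : ∀ u ∈ Ioo (l / 2) (l + 1), 0 < u := fun u hu => (half_pos hl).trans hu.1
  refine hasDerivAt_volterraOp (w' := fun u ζ => (-(j + q + 1) : ℝ) • jostWeight V j p (q + 1) x u ζ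
      + (-1 : ℝ) • jostWeight V (j + 1) p (q + 1) x u ζ)
    (Ioo_mem_nhds (half_lt_self hl) (lt_add_one l)) (convex_Ioo _ _)
    (fun u hu ζ _ => hasDerivAt_jostWeight_right hV j p q x ζ (hs u hu).ne')
    (fun u hu => integrableOn_jostWeight hV hD0 hD j p q hx (hs u hu))
    ((hi1.smul (-(j + q + 1) : ℝ)).add (hi2.smul (-1 : ℝ)))
    (((integrableOn_majorant (A := (l + 1) * (D (j + p) * (l / 2)⁻¹ ^ (q + 1 + 1)))
      (l := l + 1) (by positivity) one_pos (by positivity)).const_mul (j + q + 1 : ℝ)).add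
    (integrableOn_majorant (A := (l + 1) * (D (j + 1 + p) * (l / 2)⁻¹ ^ (q + 1 + 1)))
      (l := l + 1) (by positivity) one_pos (by positivity))) (fun u hu ζ hζ => ?_)
  refine (norm_add_le _ _).trans ?_
  rw [norm_smul, norm_smul, norm_neg, norm_neg, norm_one, one_mul, Real.norm_of_nonneg
    (by positivity)]
  refine add_le_add (mul_le_mul_of_nonneg_left ?_ (by positivity)) ?_
  · exact norm_jostWeight_le_uniform hD0 hD j p (q + 1) (half_pos hl) hx hu.1 hu.2 hζ
  · exact norm_jostWeight_le_uniform hD0 hD (j + 1) p (q + 1) (half_pos hl) hx hu.1 hu.2 hζ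

include hV hD0 hD in
theorem symbolClass_volterraOp_jostWeight {l₀ : ℝ} (hl₀ : 0 < l₀) (n : ℕ) : ∀ j p q : ℕ,
    SymbolClass l₀ n (p + 1) q (fun x l => volterraOp (jostWeight V j p q x l)) := by
  have key : ∀ j p q : ℕ, ∃ C : ℝ, ∀ x > -1, ∀ l > l₀, ‖volterraOp (jostWeight V j p q x l)‖ ≤
      C * (2 + x)⁻¹ ^ (p + 1) * l⁻¹ ^ q := by
    intro j p q
    refine ⟨D (j + p), fun x hx l hl => ?_⟩
    have hl' : 0 < l := hl₀.trans hl
    have h2x : 0 < 2 + x := by linarith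
    have hDj := hD0 (j + p)
    refine (norm_volterraOp_le_of_majorant (by positivity) h2x hl'
      (integrableOn_jostWeight hV hD0 hD j p q hx hl')
      (fun ζ hζ => norm_jostWeight_le hD0 hD j p q hx hl' hζ)).trans_eq ?_
    ring
  induction n with
  | zero => exact key
  | succ n ih =>
    intro j p q
    exact ⟨key j p q, _, _, fun x hx l hl =>
      ⟨hasDerivAt_volterraOp_jostWeight_left hV hD0 hD j p q hx (hl₀.trans hl),
        hasDerivAt_volterraOp_jostWeight_right hV hD0 hD j p q hx (hl₀.trans hl)⟩,
      ih j (p + 1) q, ((ih j p (q + 1)).const_smul _).add ((ih (j + 1) p (q + 1)).const_smul _)⟩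

include hV hD0 hD in
theorem isUnit_one_sub_volterraOp_jostWeight {x l : ℝ} (hx : x > -1) (hl : 0 < l) :
    IsUnit (1 - volterraOp (jostWeight V 0 0 1 x l)) ∧
      ‖Ring.inverse (1 - volterraOp (jostWeight V 0 0 1 x l))‖ ≤ Real.exp (D 0 * l⁻¹) := by
  have hDj := hD0 0
  have h := isUnit_one_sub_volterraOp (by positivity) (by linarith : 1 ≤ 2 + x) hl
    (integrableOn_jostWeight hV hD0 hD 0 0 1 hx hl)
    (fun ζ hζ => norm_jostWeight_le hD0 hD 0 0 1 hx hl hζ)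
  rwa [pow_zero, mul_one, pow_one] at h

include hV hD0 hD in
theorem symbolClass_jost {l₀ : ℝ} (hl₀ : 0 < l₀) (n : ℕ) :
    SymbolClass l₀ n 1 1 (fun x l => (Ring.inverse (1 - volterraOp (jostWeight V 0 0 1 x l)) *
      volterraOp (jostWeight V 0 0 1 x l)) 1 0) := by
  have hK := fun n => symbolClass_volterraOp_jostWeight hV hD0 hD hl₀ n 0 0 1
  have hu : ∀ x > -1, ∀ l > l₀, IsUnit (1 - volterraOp (jostWeight V 0 0 1 x l)) ∧
      ‖Ring.inverse (1 - volterraOp (jostWeight V 0 0 1 x l))‖ ≤ Real.exp (D 0 * l₀⁻¹) := by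
    intro x hx l hl
    have hDj := hD0 0
    have h := isUnit_one_sub_volterraOp_jostWeight hV hD0 hD hx (hl₀.trans hl)
    refine ⟨h.1, h.2.trans (Real.exp_le_exp.2 ?_)⟩
    gcongr
  have hR := SymbolClass.inverse_one_sub (A := (ℝ →ᵇ ℂ) →L[ℂ] (ℝ →ᵇ ℂ))
    (K := fun x l => volterraOp (jostWeight V 0 0 1 x l)) hl₀ hK (fun x hx l hl => (hu x hx l hl).1)
    ⟨_, fun x hx l hl => (hu x hx l hl).2⟩ n
  have hRK := SymbolClass.mul hl₀ hR (hK n)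
  simp only [zero_add] at hRK
  exact hRK.clm_comp (((BoundedContinuousFunction.evalCLM ℂ (0 : ℝ)).comp
    (ContinuousLinearMap.apply ℂ (ℝ →ᵇ ℂ) (1 : ℝ →ᵇ ℂ))).restrictScalars ℝ)

end JostWeight

theorem setIntegral_Ioi_comp_add_left {E : Type*} [NormedAddCommGroup E] [NormedSpace ℝ E]
    (g : ℝ → E) (x a : ℝ) : ∫ z in Ioi a, g (x + z) = ∫ y in Ioi (x + a), g y := by
  have h := (measurePreserving_add_left volume x).setIntegral_preimage_emb
    (measurableEmbedding_addLeft x) g (Ioi (x + a))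
  simpa using h

theorem volterra_solution_sub_one_eq {V : ℝ → ℝ} {x l : ℝ} (hl : 0 < l) {μ : ℝ → ℂ}
    (hc : Continuous μ) (hb : ∃ B : ℝ, ∀ x : ℝ, ‖μ x‖ ≤ B)
    (hμ : ∀ x : ℝ, μ x = 1 + ∫ y in Ioi x,
      ((exp (2 * I * l * (y - x)) - 1) / (2 * I * l)) * (V y : ℂ) * μ y)
    (hw : IntegrableOn (jostWeight V 0 0 1 x l) (Ioi 0))
    (hu : IsUnit (1 - volterraOp (jostWeight V 0 0 1 x l))) :
    μ x - 1 = (Ring.inverse (1 - volterraOp (jostWeight V 0 0 1 x l)) *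
      volterraOp (jostWeight V 0 0 1 x l)) 1 0 := by
  obtain ⟨B, hB⟩ := hb
  set K := volterraOp (jostWeight V 0 0 1 x l) with hK
  let g : ℝ →ᵇ ℂ := BoundedContinuousFunction.ofNormedAddCommGroup
    (fun η => μ (x + max η 0 / l)) (by fun_prop) B (fun η => hB _)
  have hg : ∀ ζ : ℝ, 0 ≤ ζ → g ζ = μ (x + ζ / l) := by
    intro ζ hζ
    change μ (x + max ζ 0 / l) = _
    rw [max_eq_left hζ]
  have hgK : ∀ η : ℝ, 0 ≤ η → g η = (1 + K g) η := by
    intro η hη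
    have hlC : (l : ℂ) ≠ 0 := ofReal_ne_zero.2 hl.ne'
    rw [hg η hη, hμ, BoundedContinuousFunction.add_apply, BoundedContinuousFunction.coe_one, Pi.one_apply, hK,
      volterraOp_apply hw]
    congr 1
    rw [← setIntegral_Ioi_comp_add_left _ x (η / l), div_eq_inv_mul,
      ← integral_comp_mul_left_Ioi' _ _ (inv_pos.2 hl), ← integral_smul,
      setIntegral_eq_of_subset_of_forall_sdiff_eq_zero measurableSet_Ioi (Ioi_subset_Ioi hη)]
    · refine setIntegral_congr_fun measurableSet_Ioi fun ζ hζ => ?_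
      have hζη : η < ζ := hζ
      rw [hg ζ (hη.trans hζη.le), volterraKernel, max_eq_left (by linarith), jostWeight,
        real_smul]
      have h1 : 2 * I * (l : ℂ) * (((x + l⁻¹ * ζ : ℝ) : ℂ) - ((x + l⁻¹ * η : ℝ) : ℂ)) =
          2 * I * ((ζ - η : ℝ) : ℂ) := by
        push_cast
        field_simp
        ring
      rw [h1, div_eq_inv_mul ζ l]
      simp only [iteratedDeriv_zero, pow_zero, one_mul, add_zero, zero_add]
      push_cast
      field_simp
    · rintro ζ ⟨-, hζ'⟩
      have : ζ ≤ η := not_lt.1 hζ'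
      rw [volterraKernel_of_nonpos (by linarith), zero_mul, zero_mul]
  have hKK : K (1 + K g) = K g := by
    ext η
    rw [hK, volterraOp_apply hw, volterraOp_apply hw, ← hK]
    refine setIntegral_congr_fun measurableSet_Ioi fun ζ hζ => ?_
    rw [hgK ζ (le_of_lt hζ)]
  have hsol : (1 - K) (1 + K g) = 1 := by
    rw [_root_.sub_apply, one_apply_eq_self, hKK, add_sub_cancel_right]
  have hR : Ring.inverse (1 - K) 1 = 1 + K g := by
    calc Ring.inverse (1 - K) 1 = (Ring.inverse (1 - K) * (1 - K)) (1 + K g) := by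
          rw [mul_apply_eq_comp, hsol]
      _ = 1 + K g := by rw [Ring.inverse_mul_cancel _ hu, one_apply_eq_self]
  have hRK : Ring.inverse (1 - K) * K = Ring.inverse (1 - K) - 1 := by
    have := Ring.inverse_mul_cancel _ hu
    rw [mul_sub, mul_one] at this
    rw [eq_sub_iff_add_eq, add_comm]
    exact (sub_eq_iff_eq_add.1 this).symm
  rw [hRK, _root_.sub_apply, hR, BoundedContinuousFunction.sub_apply, ← hgK 0 le_rfl, hg 0 le_rfl]
  simp

theorem exists_iteratedDeriv_bound {V : ℝ → ℝ} (hV : ContDiff ℝ (⊤ : ℕ∞) V) {CV : ℕ → ℝ}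
    (hVsym : ∀ k : ℕ, ∀ y ≥ (0 : ℝ),
      |iteratedDeriv k V y| ≤ CV k * (Real.sqrt (1 + y ^ 2))⁻¹ ^ (2 + k)) :
    ∃ D : ℕ → ℝ, (∀ i, 0 ≤ D i) ∧
      ∀ i, ∀ y > -1, |iteratedDeriv i V y| ≤ D i * (2 + y)⁻¹ ^ (2 + i) := by
  have key : ∀ i, ∃ D : ℝ, 0 ≤ D ∧
      ∀ y > -1, |iteratedDeriv i V y| ≤ D * (2 + y)⁻¹ ^ (2 + i) := by
    intro i
    have hc : Continuous (iteratedDeriv i V) :=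
      hV.continuous_iteratedDeriv i (by exact_mod_cast le_top)
    obtain ⟨B, hB⟩ := isCompact_Icc.exists_bound_of_continuousOn
      (hc.continuousOn (s := Icc (-1) 0))
    have hB0 : 0 ≤ B := (norm_nonneg _).trans (hB 0 (by simp))
    refine ⟨|CV i| * 3 ^ (2 + i) + B * 2 ^ (2 + i), by positivity, fun y hy => ?_⟩
    have hy2 : 0 < 2 + y := by linarith
    rw [add_mul, mul_assoc, mul_assoc, ← mul_pow, ← mul_pow]
    rcases le_total 0 y with h0 | h0
    · have hs : (Real.sqrt (1 + y ^ 2))⁻¹ ≤ 3 * (2 + y)⁻¹ := by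
        have h1 : 1 ≤ Real.sqrt (1 + y ^ 2) := Real.one_le_sqrt.2 (by nlinarith)
        have h2 : y ≤ Real.sqrt (1 + y ^ 2) := Real.le_sqrt_of_sq_le (by linarith)
        rw [← div_eq_mul_inv, inv_eq_one_div, div_le_div_iff₀ (by linarith) hy2]
        linarith
      calc |iteratedDeriv i V y| ≤ CV i * (Real.sqrt (1 + y ^ 2))⁻¹ ^ (2 + i) := hVsym i y h0
        _ ≤ |CV i| * (3 * (2 + y)⁻¹) ^ (2 + i) := by
          gcongr
          exact le_abs_self _
        _ ≤ _ := le_add_of_nonneg_right (by positivity)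
    · have hs : 1 ≤ 2 * (2 + y)⁻¹ := by
        rw [← div_eq_mul_inv, one_le_div hy2]
        linarith
      calc |iteratedDeriv i V y| ≤ B * 1 := by
            rw [mul_one]
            exact hB y ⟨hy.le, h0⟩
        _ ≤ B * (2 * (2 + y)⁻¹) ^ (2 + i) := by
          gcongr
          exact one_le_pow₀ hs
        _ ≤ _ := le_add_of_nonneg_left (by positivity)
  choose D hD0 hD using key
  exact ⟨D, hD0, hD⟩

/-- If `f` agrees with `h` on `[a, ∞)`, then its iterated derivative at the endpoint `a` is either
that of `h` or the default value `0`. -/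
theorem norm_iteratedDeriv_le_of_eqOn_Ici {E : Type*} [NormedAddCommGroup E] [NormedSpace ℝ E]
    {f h : ℝ → E} {a : ℝ} (hfh : ∀ t ≥ a, f t = h t) {m : ℕ}
    (hd : ∀ i < m, DifferentiableAt ℝ (iteratedDeriv i h) a) :
    ‖iteratedDeriv m f a‖ ≤ ‖iteratedDeriv m h a‖ := by
  cases m with
  | zero => simp [hfh a le_rfl]
  | succ m =>
    have hIoi : ∀ t > a, iteratedDeriv m f t = iteratedDeriv m h t := fun t ht =>
      Filter.EventuallyEq.iteratedDeriv_eq m <| by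
        filter_upwards [lt_mem_nhds ht] with s hs using hfh s hs.le
    rw [iteratedDeriv_succ, iteratedDeriv_succ]
    by_cases hf : DifferentiableAt ℝ (iteratedDeriv m f) a
    · have hh := hd m m.lt_succ_self
      have ha : iteratedDeriv m f a = iteratedDeriv m h a := by
        refine tendsto_nhds_unique
          (hf.continuousAt.tendsto.mono_left (nhdsWithin_le_nhds (s := Ioi a)))
          ((hh.continuousAt.tendsto.mono_left (nhdsWithin_le_nhds (s := Ioi a))).congr' ?_)
        filter_upwards [self_mem_nhdsWithin] with t ht using (hIoi t ht).symm
      have hIci : EqOn (iteratedDeriv m f) (iteratedDeriv m h) (Ici a) := by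
        intro t ht
        rcases eq_or_lt_of_le (mem_Ici.1 ht) with rfl | hlt
        · exact ha
        · exact hIoi t hlt
      have hu : UniqueDiffWithinAt ℝ (Ici a) a := uniqueDiffOn_Ici a a self_mem_Ici
      rw [← hf.derivWithin hu, ← hh.derivWithin hu, derivWithin_congr hIci ha]
    · rw [deriv_zero_of_not_differentiableAt hf, norm_zero]
      exact norm_nonneg _

end Volterra

/-- Large-energy bounds for the Jost function `m₊(x,λ) = e^{−iλx} f₊(x,λ)`:
for a smooth potential with symbol-type decay `|V^{(k)}(y)| ≤ C_k ⟨y⟩^{−2−k}` (`y ≥ 0`)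
and `∫⟨y⟩|V| < ∞`, one has `|∂_x^k ∂_λ^m (m₊ − 1)| ≤ C_{k,m} ⟨x⟩^{−1−k} λ^{−1−m}`
for all `λ ≥ λ₀ > 0` and `x ≥ 0`. -/
theorem jost_plus_large_energy_bounds
    (V : ℝ → ℝ) (hVc : Continuous V) (hVL1 : MeasureTheory.Integrable V)
    (hVw : MeasureTheory.Integrable fun y => Real.sqrt (1 + y ^ 2) * |V y|)
    (hVsm : ContDiff ℝ (⊤ : ℕ∞) V) (CV : ℕ → ℝ)
    (hVsym : ∀ k : ℕ, ∀ y ≥ (0 : ℝ),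
      |iteratedDeriv k V y| ≤ CV k * (Real.sqrt (1 + y ^ 2))⁻¹ ^ (2 + k))
    (lam₀ : ℝ) (hlam₀ : 0 < lam₀)
    (mPlus : ℝ → ℝ → ℂ)
    (hcont : ∀ lam ≥ lam₀, Continuous fun x => mPlus x lam)
    (hbd : ∀ lam ≥ lam₀, ∃ B : ℝ, ∀ x : ℝ, ‖mPlus x lam‖ ≤ B)
    (hVolt : ∀ lam ≥ lam₀, ∀ x : ℝ,
      mPlus x lam = 1 + ∫ y in Set.Ioi x,
        ((Complex.exp (2 * Complex.I * lam * (y - x)) - 1) / (2 * Complex.I * lam)) *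
          (V y : ℂ) * mPlus y lam) :
    ∀ k m : ℕ, ∃ C : ℝ, ∀ lam ≥ lam₀, ∀ x ≥ (0 : ℝ),
      ‖iteratedDeriv m (fun l : ℝ => iteratedDeriv k (fun t : ℝ => mPlus t l - 1) x) lam‖ ≤
        C * (Real.sqrt (1 + x ^ 2))⁻¹ ^ (1 + k) * lam⁻¹ ^ (1 + m) := by
  obtain ⟨D, hD0, hD⟩ := exists_iteratedDeriv_bound hVsm hVsym
  intro k m
  have hl₁ : 0 < lam₀ / 2 := by positivity
  obtain ⟨H, hH, hHeq⟩ := SymbolClass.exists_iteratedDeriv_left (n := m) k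
    (symbolClass_jost hVsm hD0 hD hl₁ (m + k))
  have hmH : ∀ lam ≥ lam₀, ∀ x > -1,
      iteratedDeriv k (fun t : ℝ => mPlus t lam - 1) x = H x lam := by
    intro lam hlam x hx
    have hl : 0 < lam := hlam₀.trans_le hlam
    rw [← hHeq x hx lam (by linarith)]
    refine Filter.EventuallyEq.iteratedDeriv_eq k ?_
    filter_upwards [lt_mem_nhds hx] with t ht
    have hw := integrableOn_jostWeight hVsm hD0 hD 0 0 1 ht hl
    have hu := (isUnit_one_sub_volterraOp_jostWeight hVsm hD0 hD ht hl).1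
    exact volterra_solution_sub_one_eq (μ := fun y => mPlus y lam) hl (hcont lam hlam) (hbd lam hlam)
      (hVolt lam hlam) hw hu
  have hHd : ∀ x > -1, ∀ i < m, DifferentiableAt ℝ (iteratedDeriv i (H x)) lam₀ := by
    intro x hx i hi
    obtain ⟨j, rfl⟩ : ∃ j, m = j + 1 + i := ⟨m - i - 1, by omega⟩
    obtain ⟨J, ⟨-, Jx, Jl, hJd, -, -⟩, hJ⟩ := hH.exists_iteratedDeriv_right i
    have hlam : lam₀ > lam₀ / 2 := by linarith
    refine (hJd x hx lam₀ hlam).2.differentiableAt.congr_of_eventuallyEq ?_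
    filter_upwards [lt_mem_nhds hlam] with l hl using hJ x hx l hl
  obtain ⟨J, hJ, hJeq⟩ := SymbolClass.exists_iteratedDeriv_right (n := 0) m
    (by rwa [zero_add] : SymbolClass (lam₀ / 2) (0 + m) (1 + k) 1 H)
  obtain ⟨C, hC0, hC⟩ := hJ.exists_nonneg_bound hl₁
  refine ⟨C, fun lam hlam x hx => ?_⟩
  have hx' : x > -1 := by linarith
  have hl : 0 < lam := hlam₀.trans_le hlam
  have hlam' : lam > lam₀ / 2 := by linarith
  calc ‖iteratedDeriv m (fun l : ℝ => iteratedDeriv k (fun t : ℝ => mPlus t l - 1) x) lam‖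
      ≤ ‖iteratedDeriv m (H x) lam‖ := by
        rcases eq_or_lt_of_le hlam with rfl | hlt
        · exact norm_iteratedDeriv_le_of_eqOn_Ici (fun l hl => hmH l hl x hx') (hHd x hx')
        · refine le_of_eq (congrArg _ (Filter.EventuallyEq.iteratedDeriv_eq m ?_))
          filter_upwards [lt_mem_nhds hlt] with l hl using hmH l hl.le x hx'
    _ ≤ C * (2 + x)⁻¹ ^ (1 + k) * lam⁻¹ ^ (1 + m) := by
        rw [hJeq x hx' lam hlam']
        exact hC x hx' lam hlam'
    _ ≤ _ := by
        gcongr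
        exact Real.sqrt_le_iff.2 ⟨by linarith, by nlinarith⟩
end
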